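/- arXiv:1902.06991 — 6 statements merged into one kernel-verified Lean document; each statement's English description precedes it below -/
import Mathlib

section
/- Let G be a group and let Y ⊆ G be a subset that is commensurated for the action of G on itself by left multiplication, and 1-ended. Let f : Y → G be a map such that for every g ∈ G, the set {h ∈ Y : g·h ∈ Y and f(g·h) ≠ g·f(h)} is finite. Then there exists a unique s ∈ G such that the set {h ∈ Y : f(h) ≠ h·s} is finite. -/
open Set

/-- A subset `Y` of a group `G` is commensurated for the action of `G` on itself by left
multiplication if `gY Δ Y` is finite for every `g ∈ G`. -/
def CommensuratedMul {G : Type*} [Group G] (Y : Set G) : Prop :=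
  ∀ g : G, ((((g * ·) '' Y) \ Y) ∪ (Y \ ((g * ·) '' Y))).Finite

/-- A commensurated subset `Y` of `G` is 1-ended if it is infinite and every commensurated
subset of `Y` is either finite or has finite complement in `Y`. -/
def OneEndedMul {G : Type*} [Group G] (Y : Set G) : Prop :=
  Y.Infinite ∧ ∀ Z : Set G, Z ⊆ Y → CommensuratedMul Z → Z.Finite ∨ (Y \ Z).Finite

theorem commensurated_fiber {G : Type*} [Group G] (Y : Set G)
    (hY : CommensuratedMul Y) (f : G → G)
    (hf : ∀ g : G, {h : G | h ∈ Y ∧ g * h ∈ Y ∧ f (g * h) ≠ g * f h}.Finite) (S : Set G) :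
    CommensuratedMul {h | h ∈ Y ∧ h⁻¹ * f h ∈ S} := by
  intro g
  refine ((hY g).union ((hf g).image (g * ·))).subset ?_
  have key : ∀ h, f (g * h) = g * f h → (g * h)⁻¹ * f (g * h) = h⁻¹ * f h := by
    intro h e
    rw [e]; group
  rintro x (⟨⟨h, ⟨hhY, hhS⟩, rfl⟩, hx⟩ | ⟨⟨hxY, hxS⟩, hx⟩)
  · by_cases hgY : g * h ∈ Y
    · refine Or.inr ⟨h, ⟨hhY, hgY, fun e => hx ⟨hgY, ?_⟩⟩, rfl⟩
      show (g * h)⁻¹ * f (g * h) ∈ S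
      rw [key h e]; exact hhS
    · exact Or.inl (Or.inl ⟨⟨h, hhY, rfl⟩, hgY⟩)
  · by_cases hgY : x ∈ (g * ·) '' Y
    · obtain ⟨h, hhY, rfl⟩ := hgY
      refine Or.inr ⟨h, ⟨hhY, hxY, fun e => hx ⟨h, ⟨hhY, ?_⟩, rfl⟩⟩, rfl⟩
      have h2 : (g * h)⁻¹ * f (g * h) ∈ S := hxS
      rwa [key h e] at h2
    · exact Or.inl (Or.inr ⟨hxY, hgY⟩)

theorem infinite_split {α : Type*} {s : Set α} (hs : s.Infinite) :
    ∃ A : Set α, (s ∩ A).Infinite ∧ (s \ A).Infinite := by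
  have e := hs.natEmbedding
  have hinj : Function.Injective (fun n => (e n : α)) :=
    Subtype.val_injective.comp e.injective
  refine ⟨range (fun n => (e (2 * n) : α)), ?_, ?_⟩
  · refine (infinite_range_of_injective (f := fun n => (e (2 * n) : α)) ?_).mono ?_
    · intro a b h
      have := hinj h
      omega
    · rintro _ ⟨n, rfl⟩
      exact ⟨(e (2 * n)).2, n, rfl⟩
  · refine (infinite_range_of_injective (f := fun n => (e (2 * n + 1) : α)) ?_).mono ?_
    · intro a b h
      have := hinj h
      omega
    · rintro _ ⟨n, rfl⟩
      refine ⟨(e (2 * n + 1)).2, ?_⟩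
      rintro ⟨m, h⟩
      have := hinj h
      omega

/-- A near-equivariant map from a 1-ended commensurated subset of a group to the group
coincides, outside a finite set, with a unique right translation. -/
theorem near_equivariant_eq_right_translation
    {G : Type*} [Group G] (Y : Set G)
    (hY : CommensuratedMul Y) (h1e : OneEndedMul Y)
    (f : G → G)
    (hf : ∀ g : G, {h : G | h ∈ Y ∧ g * h ∈ Y ∧ f (g * h) ≠ g * f h}.Finite) :
    ∃! s : G, {h : G | h ∈ Y ∧ f h ≠ h * s}.Finite := by
  obtain ⟨hinf, hend⟩ := h1e
  have hS : ∀ S : Set G, {h | h ∈ Y ∧ h⁻¹ * f h ∈ S}.Finite ∨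
      (Y \ {h | h ∈ Y ∧ h⁻¹ * f h ∈ S}).Finite := fun S =>
    hend _ (fun _ h => h.1) (commensurated_fiber Y hY f hf S)
  have hex : ∃ s : G, {h | h ∈ Y ∧ h⁻¹ * f h ∈ ({s} : Set G)}.Infinite := by
    by_contra hcon
    simp only [not_exists, Set.not_infinite] at hcon
    have him : ((fun h => h⁻¹ * f h) '' Y).Infinite := by
      intro hfin
      refine hinf ((hfin.biUnion (fun s _ => hcon s)).subset ?_)
      intro h hh
      exact mem_biUnion (mem_image_of_mem _ hh) ⟨hh, rfl⟩
    obtain ⟨A, hA, hB⟩ := infinite_split him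
    rcases hS A with h | h
    · refine hA ((h.image (fun h => h⁻¹ * f h)).subset ?_)
      rintro _ ⟨⟨h, hh, rfl⟩, hx⟩
      exact ⟨h, ⟨hh, hx⟩, rfl⟩
    · refine hB ((h.image (fun h => h⁻¹ * f h)).subset ?_)
      rintro _ ⟨⟨h, hh, rfl⟩, hx⟩
      exact ⟨h, ⟨hh, fun h' => hx h'.2⟩, rfl⟩
  obtain ⟨s, hs⟩ := hex
  have hsf : {h : G | h ∈ Y ∧ f h ≠ h * s}.Finite := by
    refine ((hS {s}).resolve_left hs).subset ?_
    rintro h ⟨hh, hne⟩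
    refine ⟨hh, fun h' => hne ?_⟩
    have h2 : h⁻¹ * f h = s := h'.2
    rw [← h2]; group
  refine ⟨s, hsf, ?_⟩
  intro t ht
  obtain ⟨h, hh, hn⟩ := (hinf.diff (hsf.union ht)).nonempty
  by_contra hne
  apply hn
  by_cases h1 : f h = h * s
  · refine Or.inr ⟨hh, fun h2 => hne ?_⟩
    exact mul_left_cancel (h2.symm.trans h1)
  · exact Or.inl ⟨hh, h1⟩
end

section
/- Let A be a finitely generated abelian group and let α, α' : A → Sym(X) be two actions of A on a set X that are finite perturbations of one another. Let X_{≥2} ⊆ X be the set of points whose α-orbit has at least quadratic growth. Then there exists a finitely supported permutation σ of X such that for every g ∈ A and every x ∈ X_{≥2}, one has σ(α'(g)(σ⁻¹(x))) = α(g)(x); that is, the finite perturbation α' is conjugate by a finitely supported permutation to an action that agrees with α on X_{≥2}. -/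
open Set

/-- extend a finitely supported partial injection to a finitely supported permutation -/
lemma pert_extend {X : Type*} (S : Set X) (φ : X → X) (hinj : Set.InjOn φ S)
    (hfin : {x | x ∈ S ∧ φ x ≠ x}.Finite) :
    ∃ τ : Equiv.Perm X, {x | τ x ≠ x}.Finite ∧ ∀ x ∈ S, τ x = φ x := by
  classical
  set F := hfin.toFinset with hF
  set E : Finset X := F ∪ F.image φ with hE
  have hmemF : ∀ x, x ∈ F ↔ x ∈ S ∧ φ x ≠ x := by intro x; simp [hF]
  have hmap : ∀ x ∈ E, x ∈ S → φ x ∈ E := by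
    intro x hx hxS
    by_cases h : φ x = x
    · rwa [h]
    · exact Finset.mem_union_right _ (Finset.mem_image_of_mem _ ((hmemF x).2 ⟨hxS, h⟩))
  obtain ⟨g, hg⟩ := Finset.exists_equiv_extend_of_card_eq (α := {x // x ∈ E}) (t := E) (by simp)
    (s := Finset.univ.filter (fun x : {x // x ∈ E} => (x : X) ∈ S)) (f := fun x => φ x)
    (by
      intro y hy
      simp only [Finset.mem_image, Finset.mem_filter, Finset.mem_univ, true_and] at hy
      obtain ⟨x, hx, rfl⟩ := hy
      exact hmap x x.2 hx)
    (by
      intro x hx y hy hxy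
      simp only [Finset.coe_filter, Finset.mem_univ, true_and, Set.mem_ofPred_eq] at hx hy
      exact Subtype.ext (hinj hx hy hxy))
  refine ⟨Equiv.Perm.ofSubtype (p := fun x => x ∈ E) g, ?_, ?_⟩
  · refine E.finite_toSet.subset ?_
    intro x hx
    by_contra h
    exact hx (Equiv.Perm.ofSubtype_apply_of_not_mem (p := fun x => x ∈ E) g h)
  · intro x hx
    by_cases h : x ∈ E
    · rw [Equiv.Perm.ofSubtype_apply_of_mem (p := fun x => x ∈ E) g h]
      exact hg ⟨x, h⟩ (by simpa using hx)
    · rw [Equiv.Perm.ofSubtype_apply_of_not_mem (p := fun x => x ∈ E) g h]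
      by_contra h'
      exact h (Finset.mem_union_left _ ((hmemF x).2 ⟨hx, fun h2 => h' h2.symm⟩))

section
variable {A X : Type*} [CommGroup A] (α α' : A →* Equiv.Perm X)

/-- the transfer function -/
def pertF (x : X) (g : A) : X := (α' g).symm (α g x)

/-- `v` is the limit of the transfer function at infinity -/
def pertLim (x v : X) : Prop := {y | ∃ g, α g x = y ∧ pertF α α' x g ≠ v}.Finite

variable {α α'}

lemma pertF_step {x : X} {s g : A} (h : α s (α g x) = α' s (α g x)) :
    pertF α α' x (s * g) = pertF α α' x g := by
  unfold pertF
  rw [Equiv.symm_apply_eq, map_mul, map_mul, Equiv.Perm.mul_apply, Equiv.Perm.mul_apply,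
    Equiv.apply_symm_apply, h]

lemma pertF_eq {x v : X} {g : A} : pertF α α' x g = v ↔ α g x = α' g v := by
  unfold pertF
  rw [Equiv.symm_apply_eq]

lemma pert_inj_orbit {x : X} {a : A} (ha : Function.Injective fun n : ℤ => α (a ^ n) x) (g : A) :
    Function.Injective fun n : ℤ => α (a ^ n) (α g x) := by
  intro m n h
  apply ha
  simp only at h ⊢
  rw [← Equiv.Perm.mul_apply, ← Equiv.Perm.mul_apply, ← map_mul, ← map_mul, mul_comm _ g,
    mul_comm _ g, map_mul, map_mul, Equiv.Perm.mul_apply, Equiv.Perm.mul_apply] at h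
  exact (α g).injective h

lemma pert_inj_nat {x : X} {a : A} (ha : Function.Injective fun n : ℤ => α (a ^ n) x) :
    Function.Injective fun n : ℕ => α (a ^ n) x := by
  intro m n h
  have := @ha (m : ℤ) (n : ℤ) (by simpa using h)
  exact_mod_cast this

lemma pert_ev {x : X} {a : A} (ha : Function.Injective fun n : ℤ => α (a ^ n) x) {B : Set X}
    (hB : B.Finite) (g : A) : ∀ᶠ n : ℕ in Filter.atTop, α (a ^ n) (α g x) ∉ B := by
  have h := pert_inj_nat (pert_inj_orbit ha g)
  have h2 := (hB.preimage h.injOn).eventually_cofinite_notMem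
  rw [Nat.cofinite_eq_atTop] at h2
  exact h2

lemma pert_lim (hpert : ∀ g : A, {x : X | α g x ≠ α' g x}.Finite) {x : X} {a : A}
    (ha : Function.Injective fun n : ℤ => α (a ^ n) x) :
    ∃ v, ∀ g, ∀ᶠ n : ℕ in Filter.atTop, pertF α α' x (a ^ n * g) = v := by
  obtain ⟨N, hN⟩ := Filter.eventually_atTop.1 (pert_ev ha (hpert a) 1)
  have hv : ∀ n ≥ N, pertF α α' x (a ^ n) = pertF α α' x (a ^ N) := by
    intro n hn
    induction n, hn using Nat.le_induction with
    | base => rfl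
    | succ n hn ih =>
      rw [pow_succ', pertF_step, ih]
      simpa using hN n hn
  refine ⟨pertF α α' x (a ^ N), fun g => ?_⟩
  filter_upwards [Filter.eventually_ge_atTop N, pert_ev ha (hpert g) 1] with n hn h2
  rw [mul_comm, pertF_step, hv n hn]
  simpa using h2

lemma pert_hit {x v : X} {a g : A}
    (hv : ∀ᶠ n : ℕ in Filter.atTop, pertF α α' x (a ^ n * g) = v)
    (hg : pertF α α' x g ≠ v) : ∃ n : ℕ, α (a ^ n * g) x ∈ {x : X | α a x ≠ α' a x} := by
  by_contra! h
  have h1 : ∀ n : ℕ, pertF α α' x (a ^ n * g) = pertF α α' x g := by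
    intro n
    induction n with
    | zero => simp
    | succ n ih =>
      rw [pow_succ', mul_assoc, pertF_step, ih]
      simpa using h n
  obtain ⟨n, hn⟩ := hv.exists
  exact hg ((h1 n).symm.trans hn)

lemma pert_exists (hpert : ∀ g : A, {x : X | α g x ≠ α' g x}.Finite) {x : X} {a b : A}
    (hab : Function.Injective fun mn : ℤ × ℤ => α (a ^ mn.1 * b ^ mn.2) x) :
    ∃ v, pertLim α α' x v := by
  have ha : Function.Injective fun n : ℤ => α (a ^ n) x := by
    intro m n h
    have := @hab (m, 0) (n, 0) (by simpa using h)
    exact (Prod.ext_iff.1 this).1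
  have ha' : Function.Injective fun n : ℤ => α (a⁻¹ ^ n) x := by
    intro m n h
    have := @ha (-m) (-n) (by simpa using h)
    simpa using this
  set B := {x : X | α a x ≠ α' a x} ∪ {x : X | α a⁻¹ x ≠ α' a⁻¹ x} with hBdef
  have hB : B.Finite := (hpert a).union (hpert a⁻¹)
  obtain ⟨v, hv⟩ := pert_lim hpert ha
  obtain ⟨w, hw⟩ := pert_lim hpert ha'
  have hvw : w = v := by
    by_contra hne
    have key : ∀ m : ℤ, ∃ n : ℤ, α (a ^ n * b ^ m) x ∈ B := by
      intro m
      by_cases h : pertF α α' x (b ^ m) = v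
      · have h' : pertF α α' x (b ^ m) ≠ w := by rw [h]; exact fun h => hne h.symm
        obtain ⟨n, hn⟩ := pert_hit (hw _) h'
        exact ⟨-n, Or.inr (by simpa using hn)⟩
      · obtain ⟨n, hn⟩ := pert_hit (hv _) h
        exact ⟨n, Or.inl (by simpa using hn)⟩
    choose n hn using key
    refine Set.infinite_of_injective_forall_mem (f := fun m : ℤ => α (a ^ n m * b ^ m) x)
      ?_ hn hB
    intro m m' h
    have := @hab (n m, m) (n m', m') h
    exact (Prod.ext_iff.1 this).2
  subst hvw
  refine ⟨w, ?_⟩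
  have hfin : (⋃ y ∈ B, {z | ∃ m n : ℕ, Function.Injective (fun n : ℤ => α (a ^ n) y) ∧
      z = α (a ^ m) y ∧ α (a ^ n) z ∈ B}).Finite := by
    refine hB.biUnion fun y _ => ?_
    by_cases hy : Function.Injective (fun n : ℤ => α (a ^ n) y)
    · have h := pert_inj_nat hy
      obtain ⟨N, hN⟩ := (hB.preimage h.injOn).bddAbove
      refine ((Set.finite_Iic N).image (fun m : ℕ => α (a ^ m) y)).subset ?_
      rintro z ⟨m, n, -, rfl, hz⟩
      refine ⟨m, ?_, rfl⟩
      have : n + m ≤ N := by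
        apply hN
        simpa [pow_add] using hz
      simp only [Set.mem_Iic]; omega
    · convert Set.finite_empty (α := X)
      ext z
      simp only [hy, false_and, exists_false, Set.mem_ofPred_eq, Set.mem_empty_iff_false]
  refine hfin.subset ?_
  rintro z ⟨g, rfl, hg⟩
  obtain ⟨n, hn⟩ := pert_hit (hv _) hg
  obtain ⟨m, hm⟩ := pert_hit (hw _) hg
  simp only [Set.mem_iUnion]
  refine ⟨α (a⁻¹ ^ m * g) x, Or.inr hm, m, n, pert_inj_orbit ha _, ?_, Or.inl ?_⟩
  · rw [← Equiv.Perm.mul_apply, ← map_mul]; simp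
  · rwa [← Equiv.Perm.mul_apply, ← map_mul]

lemma pertLim_equiv {x v : X} (h : pertLim α α' x v) (k : A) :
    pertLim α α' (α k x) (α' k v) := by
  refine h.subset ?_
  rintro y ⟨g, rfl, hg⟩
  refine ⟨g * k, by simp, fun h => hg ?_⟩
  rw [pertF_eq] at h ⊢
  simpa using h

/-- joint escape -/
lemma pert_escape {x y : X} {a b : A} (ha : Function.Injective fun n : ℤ => α (a ^ n) x)
    (hb : Function.Injective fun n : ℤ => α (b ^ n) y) {F G : Set X} (hF : F.Finite)
    (hG : G.Finite) : ∃ g, α g x ∉ F ∧ α g y ∉ G := by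
  by_contra! h
  have hb' := pert_inj_nat hb
  have h1 : ∀ᶠ n : ℕ in Filter.atTop, ∀ m ∈ Finset.range (hG.toFinset.card + 1),
      α (a ^ n) (α (b ^ m) x) ∉ F :=
    (Filter.eventually_all_finset _).2 fun m _ => pert_ev ha hF (b ^ m)
  obtain ⟨n, hn⟩ := h1.exists
  have h2 : (Finset.range (hG.toFinset.card + 1)).card ≤ hG.toFinset.card := by
    refine Finset.card_le_card_of_injOn (fun m => α (a ^ n) (α (b ^ m) y)) ?_ ?_
    · intro m hm
      have := h (a ^ n * b ^ m) (by simpa using hn m hm)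
      simpa using this
    · intro m _ m' _ hmm
      exact hb' ((α (a ^ n)).injective hmm)
  simp at h2

end

/-- A finite perturbation of an action of a finitely generated abelian group is conjugate,
by a finitely supported permutation, to an action that is unchanged on the union of orbits
of at least quadratic growth. -/
theorem perturbation_conj_fixing_quadratic_orbits
    {A X : Type*} [CommGroup A] [Group.FG A]
    (α α' : A →* Equiv.Perm X)
    (hpert : ∀ g : A, {x : X | α g x ≠ α' g x}.Finite) :
    ∃ σ : Equiv.Perm X, {x : X | σ x ≠ x}.Finite ∧
      ∀ g : A, ∀ x : X,
        (∃ a b : A, Function.Injective fun mn : ℤ × ℤ => α (a ^ mn.1 * b ^ mn.2) x) →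
        σ (α' g (σ.symm x)) = α g x := by
  classical
  set S : Set X := {x | ∃ a b : A, Function.Injective
    fun mn : ℤ × ℤ => α (a ^ mn.1 * b ^ mn.2) x} with hS
  have hS1 : ∀ x ∈ S, ∃ a : A, Function.Injective fun n : ℤ => α (a ^ n) x := by
    rintro x ⟨a, b, hab⟩
    refine ⟨a, ?_⟩
    intro m n h
    have := @hab (m, 0) (n, 0) (by simpa using h)
    exact (Prod.ext_iff.1 this).1
  have hSinv : ∀ x ∈ S, ∀ g, α g x ∈ S := by
    rintro x ⟨a, b, hab⟩ g
    refine ⟨a, b, ?_⟩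
    intro m n h
    apply hab
    have hc : ∀ k : A, α k (α g x) = α g (α k x) := by
      intro k
      rw [← Equiv.Perm.mul_apply, ← Equiv.Perm.mul_apply, ← map_mul, ← map_mul, mul_comm]
    simp only [hc] at h
    exact (α g).injective h
  have hex : ∀ x, ∃ v, x ∈ S → pertLim α α' x v := by
    intro x
    by_cases hx : x ∈ S
    · obtain ⟨a, b, hab⟩ := hx
      obtain ⟨v, hv⟩ := pert_exists hpert hab
      exact ⟨v, fun _ => hv⟩
    · exact ⟨x, fun h => absurd h hx⟩
  choose φ hφ using hex
  have huniq : ∀ x ∈ S, ∀ v, pertLim α α' x v → φ x = v := by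
    intro x hx v hv
    obtain ⟨a, ha⟩ := hS1 x hx
    obtain ⟨g, h1, h2⟩ := pert_escape ha ha (hφ x hx) hv
    have e1 : pertF α α' x g = φ x := by
      by_contra h
      exact h1 ⟨g, rfl, h⟩
    have e2 : pertF α α' x g = v := by
      by_contra h
      exact h2 ⟨g, rfl, h⟩
    exact e1.symm.trans e2
  have hequi : ∀ x ∈ S, ∀ g, φ (α g x) = α' g (φ x) := fun x hx g =>
    huniq _ (hSinv x hx g) _ (pertLim_equiv (hφ x hx) g)
  have hinj : Set.InjOn φ S := by
    intro x hx y hy hxy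
    obtain ⟨a, ha⟩ := hS1 x hx
    obtain ⟨b, hb⟩ := hS1 y hy
    obtain ⟨g, h1, h2⟩ := pert_escape ha hb (hφ x hx) (hφ y hy)
    have e1 : pertF α α' x g = φ x := by
      by_contra h
      exact h1 ⟨g, rfl, h⟩
    have e2 : pertF α α' y g = φ y := by
      by_contra h
      exact h2 ⟨g, rfl, h⟩
    rw [pertF_eq] at e1 e2
    apply (α g).injective
    rw [e1, e2, hxy]
  obtain ⟨T, hT⟩ := Group.FG.out (G := A)
  set K : Set X := ⋃ s ∈ T, {x : X | α s x ≠ α' s x} with hK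
  have hKfin : K.Finite := T.finite_toSet.biUnion fun s _ => hpert s
  have hfree : ∀ x, (∀ g, α g x ∉ K) → ∀ g : A, ∀ y, (∃ k, y = α k x) → α g y = α' g y := by
    intro x hx g
    have hg : g ∈ Subgroup.closure (T : Set A) := by rw [hT]; trivial
    induction hg using Subgroup.closure_induction with
    | mem s hs =>
      rintro y ⟨k, rfl⟩
      by_contra h
      exact hx k (Set.mem_biUnion (x := s) hs h)
    | one => simp
    | mul g h _ _ ihg ihh =>
      rintro y ⟨k, rfl⟩
      rw [map_mul, map_mul, Equiv.Perm.mul_apply, Equiv.Perm.mul_apply, ← ihh _ ⟨k, rfl⟩]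
      exact ihg _ ⟨h * k, by simp⟩
    | inv g _ ih =>
      rintro y ⟨k, rfl⟩
      have := ih (α g⁻¹ (α k x)) ⟨g⁻¹ * k, by simp⟩
      apply (α' g).injective
      rw [← this]
      simp
  have hfin : {x | x ∈ S ∧ φ x ≠ x}.Finite := by
    have hU : (⋃ k ∈ K, {z | k ∈ S ∧ ∃ g, α g k = z ∧ pertF α α' k g ≠ φ k}).Finite := by
      refine hKfin.biUnion fun k _ => ?_
      by_cases hk : k ∈ S
      · exact (hφ k hk).subset fun z hz => hz.2
      · convert Set.finite_empty (α := X)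
        ext z
        simp [hk]
    refine hU.subset ?_
    rintro z ⟨hz, hne⟩
    have : ∃ g, α g z ∈ K := by
      by_contra! h
      apply hne
      apply huniq z hz
      convert Set.finite_empty (α := X)
      unfold pertLim
      have he : {y | ∃ g, α g z = y ∧ pertF α α' z g ≠ z} = ∅ := by
        ext y
        simp only [Set.mem_ofPred_eq, Set.mem_empty_iff_false, iff_false]
        rintro ⟨g, -, hg⟩
        exact hg (pertF_eq.2 (hfree z h g z ⟨1, by simp⟩))
      rw [he]
    obtain ⟨g, hg⟩ := this
    simp only [Set.mem_iUnion]
    refine ⟨α g z, hg, hSinv z hz g, g⁻¹, by simp, fun h => hne ?_⟩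
    rw [pertF_eq, hequi z hz] at h
    simpa using h.symm
  obtain ⟨τ, hτ, hτφ⟩ := pert_extend S φ hinj hfin
  refine ⟨τ.symm, hτ.subset ?_, ?_⟩
  · intro x hx h
    exact hx (by rw [Equiv.symm_apply_eq, h])
  · intro g x hx
    rw [Equiv.symm_apply_eq, Equiv.symm_symm, hτφ x hx, hτφ _ (hSinv x hx g), hequi x hx]
end

section
/- Let G be a 1-ended group that is not locally finite. Let α : G → Sym(X) be a free action of G on a set X (i.e., α(g)(x) ≠ x for every g ≠ 1 and every x ∈ X), and let α' : G → Sym(X) be an action that is a finite perturbation of α. Then there exists a unique finitely supported permutation σ of X such that σ ∘ α(g) ∘ σ⁻¹ = α'(g) for all g ∈ G. -/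
open Set

/-- A group is 1-ended if it is infinite and every commensurated subset of it (for the left
multiplication action on itself) is finite or cofinite. -/
def OneEndedGroup (G : Type*) [Group G] : Prop :=
  Infinite G ∧ ∀ Y : Set G, CommensuratedMul Y → Y.Finite ∨ Yᶜ.Finite

theorem aux_const {G X : Type*} [Infinite G] (f : G → X)
    (h : ∀ A : Set X, (f ⁻¹' A).Finite ∨ (f ⁻¹' A)ᶜ.Finite) :
    ∃ y, {g | f g ≠ y}.Finite := by
  by_contra hcon
  push Not at hcon
  have hfib : ∀ y, (f ⁻¹' {y}).Finite := fun y => (h {y}).resolve_right (hcon y)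
  have hr : (Set.range f).Infinite := by
    intro hfin
    have : (f ⁻¹' (Set.range f)).Finite := hfin.preimage' (fun b _ => hfib b)
    rw [Set.preimage_range] at this
    exact Set.infinite_univ this
  let e := hr.natEmbedding
  have hinj : Function.Injective (fun n => (e n : X)) :=
    fun a b hab => e.injective (Subtype.ext hab)
  choose k hk using fun n => (e n).2
  have hkinj : Function.Injective k := by
    intro a b hab
    apply hinj
    simp only
    rw [← hk a, ← hk b, hab]
  rcases h (Set.range fun n => (e (2 * n) : X)) with h1 | h1
  · refine Set.infinite_of_injective_forall_mem (f := fun n => k (2 * n)) ?_ ?_ h1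
    · intro a b hab
      have := hkinj hab
      omega
    · intro n
      exact ⟨n, (hk _).symm⟩
  · refine Set.infinite_of_injective_forall_mem (f := fun n => k (2 * n + 1)) ?_ ?_ h1
    · intro a b hab
      have := hkinj hab
      omega
    · rintro n ⟨m, hm⟩
      have : 2 * m = 2 * n + 1 := hinj (hm.trans (hk _))
      omega

/-- Any finite perturbation of a free action of a 1-ended, not locally finite group is
conjugate to the original action by a unique finitely supported permutation. -/
theorem perturbation_of_free_action_conjugate
    {G X : Type*} [Group G]
    (h1e : OneEndedGroup G)
    (hnlf : ¬ ∀ H : Subgroup G, H.FG → (H : Set G).Finite)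
    (α α' : G →* Equiv.Perm X)
    (hfree : ∀ g : G, g ≠ 1 → ∀ x : X, α g x ≠ x)
    (hpert : ∀ g : G, {x : X | α g x ≠ α' g x}.Finite) :
    ∃! σ : Equiv.Perm X, {x : X | σ x ≠ x}.Finite ∧
      ∀ g : G, σ * α g * σ⁻¹ = α' g := by
  obtain ⟨hinf, hone⟩ := h1e
  have hinj : ∀ x : X, Function.Injective (fun g => α g x) := by
    intro x a b hab
    by_contra hne
    refine hfree (b⁻¹ * a) (fun h => hne (inv_mul_eq_one.mp h).symm) x ?_
    simp only at hab
    simp [hab]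
  -- infinite-meets-cofinite helper
  have hmeet : ∀ S : Set G, S.Finite → ∃ g, g ∉ S := fun S hS => hS.exists_notMem
  have key : ∀ x : X, ∃ y, {g | (α' g)⁻¹ (α g x) ≠ y}.Finite := by
    intro x
    apply aux_const
    intro A
    apply hone
    intro g
    refine ((hpert g⁻¹).preimage (hinj x).injOn).subset ?_
    intro k hk
    by_contra hbad
    have hb : α g⁻¹ (α k x) = α' g⁻¹ (α k x) := by
      by_contra h
      exact hbad h
    have hfk : (α' (g⁻¹ * k))⁻¹ (α (g⁻¹ * k) x) = (α' k)⁻¹ (α k x) := by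
      rw [map_mul α, Equiv.Perm.mul_apply, hb, map_mul, mul_inv_rev, Equiv.Perm.mul_apply]
      simp
    simp only [Set.image_mul_left, Set.mem_union, Set.mem_sdiff, Set.mem_preimage, hfk] at hk
    tauto
  choose s hs using key
  have hequi : ∀ h x, s (α h x) = α' h (s x) := by
    intro h x
    obtain ⟨g, hg⟩ := hmeet _ ((hs (α h x)).union
      ((hs x).preimage (f := fun g => g * h) (mul_left_injective h).injOn))
    simp only [Set.mem_union, Set.mem_preimage, Set.mem_ofPred_eq, not_or, not_not] at hg
    rw [← hg.1, ← hg.2]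
    simp
  have hsinj : Function.Injective s := by
    intro x y hxy
    obtain ⟨g, hg⟩ := hmeet _ ((hs x).union (hs y))
    simp only [Set.mem_union, Set.mem_ofPred_eq, not_or, not_not] at hg
    have := hg.1.trans (hxy.trans hg.2.symm)
    exact (α g).injective ((α' g)⁻¹.injective this)
  have hsupp : {x | s x ≠ x}.Finite := by
    push Not at hnlf
    obtain ⟨H, ⟨S, rfl⟩, hHinf⟩ := hnlf
    have hB : (⋃ t ∈ S, {x : X | α t x ≠ α' t x}).Finite :=
      S.finite_toSet.biUnion (fun t _ => hpert t)
    refine (hB.biUnion (fun b _ => (hs b).image (fun h => α h b))).subset ?_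
    intro x hx
    by_cases hav : ∀ h ∈ Subgroup.closure (S : Set G), α h x ∉ ⋃ t ∈ S, {x : X | α t x ≠ α' t x}
    · exfalso
      have hcl : ∀ h ∈ Subgroup.closure (S : Set G), ∀ k ∈ Subgroup.closure (S : Set G),
          α' h (α k x) = α (h * k) x := by
        intro h hh
        induction hh using Subgroup.closure_induction with
        | mem t ht =>
          intro k hk
          have := hav k hk
          simp only [Set.mem_iUnion, not_exists, Set.mem_ofPred_eq, not_not] at this
          rw [← this t ht]; simp
        | one => simp
        | mul a b ha hb iha ihb =>
          intro k hk
          rw [map_mul, Equiv.Perm.mul_apply, ihb k hk, iha _ (mul_mem hb hk), mul_assoc]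
        | inv a ha iha =>
          intro k hk
          rw [map_inv, Equiv.Perm.inv_eq_iff_eq, iha _ (mul_mem (inv_mem ha) hk)]
          simp
      apply hx
      obtain ⟨g, hg, hg'⟩ := (Set.Infinite.sdiff hHinf (hs x)).nonempty
      simp only [Set.mem_ofPred_eq, not_not] at hg'
      rw [← hg', Equiv.Perm.inv_eq_iff_eq]
      have := hcl g hg 1 (one_mem _)
      simpa using this.symm
    · push Not at hav
      obtain ⟨h, -, hb⟩ := hav
      refine Set.mem_biUnion hb ⟨h⁻¹, ?_, by simp⟩
      intro heq
      apply hx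
      have h2 := hequi h⁻¹ (α h x)
      rw [← heq] at h2
      simpa using h2
  have hssurj : Function.Surjective s := by
    intro y
    by_cases hy : s y = y
    · exact ⟨y, hy⟩
    · have hm : Set.MapsTo s {x | s x ≠ x} {x | s x ≠ x} := fun x hx h => hx (hsinj h)
      have hsurjOn : Set.SurjOn s {x | s x ≠ x} {x | s x ≠ x} := by
        have := Set.eq_of_subset_of_ncard_le hm.image_subset
          (by rw [Set.ncard_image_of_injective _ hsinj]) hsupp
        exact this.ge
      obtain ⟨x, -, hx⟩ := hsurjOn hy
      exact ⟨x, hx⟩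
  refine ⟨Equiv.ofBijective s ⟨hsinj, hssurj⟩, ⟨hsupp, ?_⟩, ?_⟩
  · intro g
    rw [mul_inv_eq_iff_eq_mul]
    ext x
    exact hequi g x
  · rintro τ ⟨hτ, hτc⟩
    ext x
    change τ x = s x
    obtain ⟨g, hg⟩ := hmeet _ ((hs x).union (hτ.preimage (hinj x).injOn))
    simp only [Set.mem_union, Set.mem_preimage, Set.mem_ofPred_eq, not_or, not_not] at hg
    rw [← hg.1, eq_comm, Equiv.Perm.inv_eq_iff_eq, ← hτc g]
    simp [hg.2]
end

section
/- Let A be a finitely generated abelian group acting on a set X with finitely many orbits. Let τ be a permutation of X with τ ∘ τ = id and τ(x) ≠ x for all x ∈ X, such that for every g ∈ A the set {x ∈ X : τ(g·x) ≠ g·τ(x)} is finite (near equivariance), and for every g ∈ A the set {x ∈ X : g·x = τ(x)} is finite (condition (∗)). Then there exist n ≥ 0 and subsets X₀, X₁, …, Xₙ of X such that the 2(n+1) sets X₀, τ(X₀), X₁, τ(X₁), …, Xₙ, τ(Xₙ) are pairwise disjoint with union X, the set X₀ is finite, and for each i ≥ 1 the set Xᵢ is A-commensurated and 1-ended. -/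
open Set

/-- A subset `Y ⊆ X` is commensurated for an action `α` of `A` on `X` if `α(g)(Y) Δ Y` is
finite for every `g ∈ A`. -/
def CommensuratedAct {A X : Type*} [Group A] (α : A →* Equiv.Perm X) (Y : Set X) : Prop :=
  ∀ g : A, (((α g '' Y) \ Y) ∪ (Y \ (α g '' Y))).Finite

/-- A commensurated subset `Y ⊆ X` is 1-ended if it is infinite and every commensurated
subset of `Y` is either finite or has finite complement in `Y`. -/
def OneEndedAct {A X : Type*} [Group A] (α : A →* Equiv.Perm X) (Y : Set X) : Prop :=
  Y.Infinite ∧ ∀ Z : Set X, Z ⊆ Y → CommensuratedAct α Z → Z.Finite ∨ (Y \ Z).Finite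

namespace Decomp

open Filter

variable {A X : Type*} [CommGroup A] {α : A →* Equiv.Perm X}

lemma comm_iff {Y : Set X} :
    CommensuratedAct α Y ↔ ∀ g : A, {x | ¬ (α g x ∈ Y ↔ x ∈ Y)}.Finite := by
  have key : ∀ g : A, (((α g⁻¹ '' Y) \ Y) ∪ (Y \ (α g⁻¹ '' Y))) =
      {x | ¬ (α g x ∈ Y ↔ x ∈ Y)} := by
    intro g
    have h : ∀ x, x ∈ α g⁻¹ '' Y ↔ α g x ∈ Y := by
      intro x
      constructor
      · rintro ⟨y, hy, rfl⟩
        simpa using hy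
      · intro hx
        exact ⟨_, hx, by simp⟩
    ext x
    simp only [mem_union, Set.mem_sdiff, h, mem_ofPred_eq]
    tauto
  constructor
  · intro h g
    rw [← key]
    exact h g⁻¹
  · intro h g
    have := h g⁻¹
    rw [← key] at this
    simpa using this

lemma comm_compl {Y : Set X} (h : CommensuratedAct α Y) : CommensuratedAct α Yᶜ := by
  rw [comm_iff] at *
  intro g
  refine (h g).subset ?_
  intro x
  simp only [mem_ofPred_eq, mem_compl_iff]
  tauto

lemma comm_inter {Y Z : Set X} (h : CommensuratedAct α Y) (h' : CommensuratedAct α Z) :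
    CommensuratedAct α (Y ∩ Z) := by
  rw [comm_iff] at *
  intro g
  refine ((h g).union (h' g)).subset ?_
  intro x
  simp only [mem_ofPred_eq, mem_inter_iff, mem_union]
  tauto

lemma comm_diff {Y Z : Set X} (h : CommensuratedAct α Y) (h' : CommensuratedAct α Z) :
    CommensuratedAct α (Y \ Z) := comm_inter h (comm_compl h')

lemma comm_orbit (t : X) : CommensuratedAct α (range fun g : A => α g t) := by
  rw [comm_iff]
  intro g
  convert Set.finite_empty
  ext x
  simp only [mem_ofPred_eq, mem_range, mem_empty_iff_false, iff_false, not_not]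
  constructor
  · rintro ⟨k, hk⟩
    exact ⟨g⁻¹ * k, by simp [hk]⟩
  · rintro ⟨k, rfl⟩
    exact ⟨g * k, by simp⟩

lemma mem_image_tau {τ : X → X} (hτ2 : ∀ x : X, τ (τ x) = x) (Z : Set X) (x : X) :
    x ∈ τ '' Z ↔ τ x ∈ Z := by
  constructor
  · rintro ⟨y, hy, rfl⟩
    rwa [hτ2]
  · intro h
    exact ⟨_, h, hτ2 x⟩

lemma comm_tau {τ : X → X} (hτ2 : ∀ x : X, τ (τ x) = x)
    (hnear : ∀ g : A, {x : X | τ (α g x) ≠ α g (τ x)}.Finite) {Z : Set X}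
    (h : CommensuratedAct α Z) : CommensuratedAct α (τ '' Z) := by
  rw [comm_iff] at *
  intro g
  refine ((hnear g).union ((h g).image τ)).subset ?_
  intro x
  simp only [mem_ofPred_eq, mem_image_tau hτ2, mem_union]
  intro hx
  by_cases h1 : τ (α g x) = α g (τ x)
  · right
    rwa [h1] at hx
  · left
    exact h1

lemma stab {P : ℕ → Prop} (h : {n | ¬ (P (n + 1) ↔ P n)}.Finite) :
    (∀ᶠ n in atTop, P n) ∨ (∀ᶠ n in atTop, ¬ P n) := by
  obtain ⟨N, hN⟩ := h.bddAbove
  have key : ∀ n, P (N + 1 + n) ↔ P (N + 1) := by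
    intro n
    induction n with
    | zero => rfl
    | succ k ih =>
      rw [← ih]
      by_contra hc
      have := hN (a := N + 1 + k) hc
      omega
  by_cases hP : P (N + 1)
  · left
    filter_upwards [eventually_ge_atTop (N + 1)] with n hn
    obtain ⟨k, rfl⟩ := Nat.exists_eq_add_of_le hn
    exact (key k).2 hP
  · right
    filter_upwards [eventually_ge_atTop (N + 1)] with n hn
    obtain ⟨k, rfl⟩ := Nat.exists_eq_add_of_le hn
    exact fun h => hP ((key k).1 h)

/-- The sequence attached to an end. -/
def sq (α : A →* Equiv.Perm X) (e : X × A) (n : ℕ) : X := α (e.2 ^ n) e.1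

lemma sq_succ (e : X × A) (n : ℕ) : sq α e (n + 1) = α e.2 (sq α e n) := by
  simp [sq, pow_succ']

lemma sq_not_mem {e : X × A} (he : Function.Injective (sq α e)) {F : Set X} (hF : F.Finite) :
    ∀ᶠ n in atTop, sq α e n ∉ F := by
  have := (hF.preimage (f := sq α e) he.injOn)
  rw [← Nat.cofinite_eq_atTop]
  exact this.eventually_cofinite_notMem

lemma sq_dich {e : X × A} (he : Function.Injective (sq α e)) {Z : Set X}
    (hZ : CommensuratedAct α Z) :
    (∀ᶠ n in atTop, sq α e n ∈ Z) ∨ (∀ᶠ n in atTop, sq α e n ∉ Z) := by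
  apply stab
  refine ((comm_iff.1 hZ e.2).preimage (f := sq α e) he.injOn).subset ?_
  intro n hn
  simpa [sq_succ] using hn

lemma exists_elt [Group.FG A] {t : X} (ht : (range fun g : A => α g t).Infinite) :
    ∃ h : A, ∀ n : ℕ, 0 < n → α (h ^ n) t ≠ t := by
  by_contra! hc
  let H : Subgroup A :=
    { carrier := {g | α g t = t}
      one_mem' := by simp
      mul_mem' := by
        intro a b ha hb
        simp only [mem_ofPred_eq] at *
        simp [ha, hb]
      inv_mem' := by
        intro a ha
        simp only [mem_ofPred_eq] at *
        rw [map_inv, Equiv.Perm.inv_eq_iff_eq, ha] }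
  have hH : ∀ g, g ∈ H ↔ α g t = t := fun g => Iff.rfl
  have htor : IsMulTorsion (A ⧸ H) := by
    intro q
    induction q using QuotientGroup.induction_on with
    | H g =>
      obtain ⟨n, hn, h⟩ := hc g
      rw [isOfFinOrder_iff_pow_eq_one]
      refine ⟨n, hn, ?_⟩
      rw [← QuotientGroup.mk_pow, QuotientGroup.eq_one_iff]
      exact h
  have hfin : Finite (A ⧸ H) := CommGroup.finite_of_fg_isMulTorsion _ htor
  apply ht
  refine (Set.finite_range (fun q : A ⧸ H => α q.out t)).subset ?_
  rintro _ ⟨g, rfl⟩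
  refine ⟨(g : A ⧸ H), ?_⟩
  obtain ⟨k, hk⟩ := QuotientGroup.mk_out_eq_mul H g
  simp only [hk]
  simp [(hH _).1 k.2]

lemma sq_inj {t : X} {h : A} (hh : ∀ n : ℕ, 0 < n → α (h ^ n) t ≠ t) :
    Function.Injective (sq α (t, h)) := by
  have key : ∀ m k : ℕ, sq α (t, h) m = sq α (t, h) (m + k) → k = 0 := by
    intro m k hmk
    by_contra hk
    refine hh k (Nat.pos_of_ne_zero hk) ?_
    simp only [sq, pow_add, map_mul, Equiv.Perm.mul_apply] at hmk
    exact ((α (h ^ m)).injective (by simpa using hmk)).symm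
  intro m n hmn
  rcases le_total m n with hle | hle
  · obtain ⟨k, rfl⟩ := Nat.exists_eq_add_of_le hle
    simp [key m k hmn]
  · obtain ⟨k, rfl⟩ := Nat.exists_eq_add_of_le hle
    simp [key n k hmn.symm]

lemma inv_ne {t : X} {h : A} (hh : ∀ n : ℕ, 0 < n → α (h ^ n) t ≠ t) :
    ∀ n : ℕ, 0 < n → α (h⁻¹ ^ n) t ≠ t := by
  intro n hn hc
  apply hh n hn
  rw [inv_pow, map_inv, Equiv.Perm.inv_eq_iff_eq] at hc
  exact hc.symm

lemma ev_translate {e : X × A} (he : Function.Injective (sq α e)) {Z : Set X}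
    (hZ : CommensuratedAct α Z) (hev : ∀ᶠ n in atTop, sq α e n ∉ Z) (g : A) :
    ∀ᶠ n : ℕ in atTop, α (e.2 ^ n) (α g e.1) ∉ Z := by
  filter_upwards [hev, sq_not_mem he (comm_iff.1 hZ g)] with n h1 h2
  have : α (e.2 ^ n) (α g e.1) = α g (sq α e n) := by
    simp only [sq, ← Equiv.Perm.mul_apply, ← map_mul, mul_comm]
  rw [this]
  simp only [mem_ofPred_eq, not_not] at h2
  rwa [h2]

lemma orbit_fin {t : X} {h : A} (hh : ∀ n : ℕ, 0 < n → α (h ^ n) t ≠ t) {Z : Set X}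
    (hZ : CommensuratedAct α Z) (h1 : ∀ᶠ n in atTop, sq α (t, h) n ∉ Z)
    (h2 : ∀ᶠ n in atTop, sq α (t, h⁻¹) n ∉ Z) : (Z ∩ range fun g : A => α g t).Finite := by
  have hD := comm_iff.1 hZ h
  set D := {x | ¬ (α h x ∈ Z ↔ x ∈ Z)} with hDdef
  have hfin : (⋃ d ∈ D ∩ (range fun g : A => α g t),
      (fun n : ℕ => α (h⁻¹ ^ n) d) '' {n | α (h⁻¹ ^ n) d ∈ Z}).Finite := by
    apply Set.Finite.biUnion (hD.inter_of_left _)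
    rintro d ⟨-, g, rfl⟩
    apply Set.Finite.image
    have := ev_translate (sq_inj (inv_ne hh)) hZ h2 g
    rw [← Nat.cofinite_eq_atTop] at this
    simpa [Filter.Eventually, mem_cofinite, Set.compl_ofPred] using this
  refine hfin.subset ?_
  rintro x ⟨hxZ, g, rfl⟩
  have hev := ev_translate (sq_inj hh) hZ h1 g
  obtain ⟨N, hN⟩ := hev.exists
  simp only at hN
  have hex : ∃ n : ℕ, α (h ^ n) (α g t) ∉ Z := ⟨N, hN⟩
  classical
  obtain ⟨m, hm⟩ : ∃ m, Nat.find hex = m + 1 := by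
    refine Nat.exists_eq_succ_of_ne_zero ?_
    intro h0
    have := Nat.find_spec hex
    rw [h0] at this
    simp at this
    exact this hxZ
  have hm1 := Nat.find_spec hex
  rw [hm] at hm1
  have hm2 : α (h ^ m) (α g t) ∈ Z := by
    by_contra hc
    have := Nat.find_min' hex hc
    omega
  simp only [mem_iUnion]
  refine ⟨α (h ^ m) (α g t), ⟨?_, h ^ m * g, by simp⟩, m, ?_, ?_⟩
  · simp only [hDdef, mem_ofPred_eq]
    intro hiff
    apply hm1
    rw [pow_succ', map_mul, Equiv.Perm.mul_apply]
    exact hiff.2 hm2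
  · simpa using hxZ
  · simp

lemma exists_ends [Group.FG A]
    (horb : ∃ T : Finset X, ∀ x : X, ∃ t ∈ T, ∃ g : A, α g t = x) :
    ∃ E : Finset (X × A), (∀ e ∈ E, Function.Injective (sq α e)) ∧
      ∀ Z, CommensuratedAct α Z → (∀ e ∈ E, ∀ᶠ n in atTop, sq α e n ∉ Z) → Z.Finite := by
  classical
  obtain ⟨T, hT⟩ := horb
  have hch : ∀ t : X, ∃ h : A, (range fun g : A => α g t).Infinite →
      ∀ n : ℕ, 0 < n → α (h ^ n) t ≠ t := by
    intro t
    by_cases ht : (range fun g : A => α g t).Infinite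
    · obtain ⟨h, hh⟩ := exists_elt ht
      exact ⟨h, fun _ => hh⟩
    · exact ⟨1, fun h => absurd h ht⟩
  choose h hh using hch
  let T' := T.filter fun t => (range fun g : A => α g t).Infinite
  refine ⟨T'.image (fun t => (t, h t)) ∪ T'.image (fun t => (t, (h t)⁻¹)), ?_, ?_⟩
  · intro e he
    simp only [Finset.mem_union, Finset.mem_image, T', Finset.mem_filter] at he
    rcases he with ⟨t, ⟨-, ht⟩, rfl⟩ | ⟨t, ⟨-, ht⟩, rfl⟩
    · exact sq_inj (hh t ht)
    · exact sq_inj (inv_ne (hh t ht))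
  · intro Z hZ hE
    have : (⋃ t ∈ (T : Set X), Z ∩ range fun g : A => α g t).Finite := by
      apply Set.Finite.biUnion T.finite_toSet
      intro t htT
      by_cases ht : (range fun g : A => α g t).Infinite
      · have ht' : t ∈ T' := Finset.mem_filter.2 ⟨htT, ht⟩
        refine orbit_fin (hh t ht) hZ (hE _ ?_) (hE _ ?_)
        · exact Finset.mem_union_left _ (Finset.mem_image_of_mem _ ht')
        · exact Finset.mem_union_right _ (Finset.mem_image.2 ⟨t, ht', rfl⟩)
      · exact (Set.not_infinite.1 ht).inter_of_right _
    refine this.subset ?_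
    intro x hx
    obtain ⟨t, ht, g, hg⟩ := hT x
    simp only [mem_iUnion]
    exact ⟨t, ht, hx, g, hg⟩

/-- An infinite one-ended set is almost disjoint from its image under the involution. -/
lemma inter_tau_fin {E : Finset (X × A)} (hE1 : ∀ e ∈ E, Function.Injective (sq α e))
    (hE2 : ∀ Z, CommensuratedAct α Z → (∀ e ∈ E, ∀ᶠ n in atTop, sq α e n ∉ Z) → Z.Finite)
    {τ : X → X} (hτ2 : ∀ x : X, τ (τ x) = x)
    (hnear : ∀ g : A, {x : X | τ (α g x) ≠ α g (τ x)}.Finite)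
    (hstar : ∀ g : A, {x : X | α g x = τ x}.Finite)
    {Z : Set X} (hZ : CommensuratedAct α Z) (hZ1 : OneEndedAct α Z) : (Z ∩ τ '' Z).Finite := by
  have hcτ := comm_tau hτ2 hnear hZ
  rcases hZ1.2 _ inter_subset_left (comm_inter hZ hcτ) with hf | hf
  · exact hf
  exfalso
  obtain ⟨e, he, hev⟩ : ∃ e ∈ E, ∀ᶠ n in atTop, sq α e n ∈ Z := by
    by_contra! hc
    refine hZ1.1 (hE2 Z hZ fun e he => ?_)
    rcases sq_dich (hE1 e he) hZ with h | h
    · obtain ⟨n, h1, h2⟩ := ((hc e he).and_eventually h).exists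
      exact absurd h2 h1
    · exact h
  have hinj := hE1 e he
  set O := range fun g : A => α g e.1 with hO
  have hsO : ∀ n, sq α e n ∈ O := fun n => ⟨_, rfl⟩
  have hZO : (Z \ O).Finite := by
    rcases hZ1.2 (Z ∩ O) inter_subset_left (comm_inter hZ (comm_orbit _)) with h | h
    · exfalso
      obtain ⟨n, h1, h2⟩ := (hev.and (sq_not_mem hinj h)).exists
      exact h2 ⟨h1, hsO n⟩
    · refine h.subset ?_
      rintro x ⟨h1, h2⟩
      exact ⟨h1, fun h => h2 h.2⟩
  have hev2 : ∀ᶠ n in atTop, τ (sq α e n) ∈ O ∧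
      τ (α e.2 (sq α e n)) = α e.2 (τ (sq α e n)) := by
    filter_upwards [hev, sq_not_mem hinj hf, sq_not_mem hinj (hZO.image τ),
      sq_not_mem hinj (hnear e.2)] with n h1 h2 h3 h4
    rw [mem_image_tau hτ2] at h3
    have h5 : τ (sq α e n) ∈ Z := by
      by_contra hc
      refine h2 ⟨h1, fun h => hc ?_⟩
      exact (mem_image_tau hτ2 _ _).1 h.2
    refine ⟨?_, by simpa using h4⟩
    by_contra hc
    exact h3 ⟨h5, hc⟩
  obtain ⟨N, hN⟩ := eventually_atTop.1 hev2
  obtain ⟨k, hk⟩ := (hN N le_rfl).1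
  set g := k * (e.2 ^ N)⁻¹ with hg
  have key : ∀ n, N ≤ n → τ (sq α e n) = α g (sq α e n) := by
    intro n hn
    induction n, hn using Nat.le_induction with
    | base =>
      rw [← hk, hg]
      simp [sq]
    | succ n hn ih =>
      rw [sq_succ, (hN n hn).2, ih]
      simp only [← Equiv.Perm.mul_apply, ← map_mul, mul_comm]
  obtain ⟨n, h1, h2⟩ := ((eventually_ge_atTop N).and (sq_not_mem hinj (hstar g))).exists
  exact h2 (key n h1).symm

lemma half {τ : X → X} (hτ2 : ∀ x : X, τ (τ x) = x) (hτfix : ∀ x : X, τ x ≠ x) {Y : Set X}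
    (hY : ∀ x, τ x ∈ Y ↔ x ∈ Y) :
    ∃ W : Set X, Disjoint W (τ '' W) ∧ W ∪ τ '' W = Y := by
  let r : X → X → Prop := WellOrderingRel
  refine ⟨{x ∈ Y | r x (τ x)}, ?_, ?_⟩
  · rw [Set.disjoint_left]
    intro x hx hx'
    rw [mem_image_tau hτ2] at hx'
    have h1 := hx.2
    have h2 := hx'.2
    rw [hτ2] at h2
    exact asymm_of WellOrderingRel h1 h2
  · ext x
    simp only [mem_union, mem_image_tau hτ2, mem_ofPred_eq, hY, hτ2]
    constructor
    · rintro (h | h) <;> exact h.1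
    · intro h
      rcases trichotomous_of WellOrderingRel x (τ x) with h1 | h1 | h1
      · exact Or.inl ⟨h, h1⟩
      · exact absurd h1.symm (hτfix x)
      · exact Or.inr ⟨h, h1⟩

/-- Ends of a set. -/
noncomputable def ends (α : A →* Equiv.Perm X) (E : Finset (X × A)) (Z : Set X) :
    Finset (X × A) := by
  classical
  exact E.filter fun e => ∀ᶠ n in atTop, sq α e n ∈ Z

lemma mem_ends {E : Finset (X × A)} {Z : Set X} {e : X × A} :
    e ∈ ends α E Z ↔ e ∈ E ∧ ∀ᶠ n in atTop, sq α e n ∈ Z := by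
  simp [ends]

lemma ends_mono {E : Finset (X × A)} {Z W : Set X} (h : Z ⊆ W) :
    ends α E Z ⊆ ends α E W := by
  intro e he
  rw [mem_ends] at *
  exact ⟨he.1, he.2.mono fun _ hn => h hn⟩

/-- If `Z ⊆ W`, and the number of ends of `W \ Z` is not smaller, then `Z` is finite. -/
lemma ends_lt {E : Finset (X × A)} (hE1 : ∀ e ∈ E, Function.Injective (sq α e))
    (hE2 : ∀ Z, CommensuratedAct α Z → (∀ e ∈ E, ∀ᶠ n in atTop, sq α e n ∉ Z) → Z.Finite)
    {Z W V : Set X} (hZ : CommensuratedAct α Z) (h : Z ⊆ W) (hV : V ⊆ W) (hd : Disjoint V Z)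
    (hi : Z.Infinite) : (ends α E V).card < (ends α E W).card := by
  apply Finset.card_lt_card
  rw [Finset.ssubset_iff_of_subset (ends_mono hV)]
  by_contra! hc
  refine hi (hE2 Z hZ fun e he => ?_)
  rcases sq_dich (hE1 e he) hZ with h1 | h1
  · exfalso
    have h2 := hc e (mem_ends.2 ⟨he, h1.mono fun _ hn => h hn⟩)
    obtain ⟨n, h3, h4⟩ := ((mem_ends.1 h2).2.and h1).exists
    exact Set.disjoint_left.1 hd h3 h4
  · exact h1

lemma exists_oneEnded {E : Finset (X × A)} (hE1 : ∀ e ∈ E, Function.Injective (sq α e))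
    (hE2 : ∀ Z, CommensuratedAct α Z → (∀ e ∈ E, ∀ᶠ n in atTop, sq α e n ∉ Z) → Z.Finite)
    (n : ℕ) : ∀ Y : Set X, CommensuratedAct α Y → Y.Infinite → (ends α E Y).card = n →
    ∃ Z ⊆ Y, CommensuratedAct α Z ∧ OneEndedAct α Z := by
  induction n using Nat.strong_induction_on with
  | _ n ih =>
    intro Y hY hi hn
    by_cases h1 : OneEndedAct α Y
    · exact ⟨Y, subset_rfl, hY, h1⟩
    · simp only [OneEndedAct, hi, true_and, not_forall, not_or] at h1
      obtain ⟨Z, hZY, hZ, hZi, hZc⟩ := h1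
      have hlt := ends_lt hE1 hE2 (comm_diff hY hZ) sdiff_subset hZY disjoint_sdiff_right hZc
      obtain ⟨W, hW, hW'⟩ := ih _ (hn ▸ hlt) Z hZ hZi rfl
      exact ⟨W, hW.trans hZY, hW'⟩

lemma main {E : Finset (X × A)} (hE1 : ∀ e ∈ E, Function.Injective (sq α e))
    (hE2 : ∀ Z, CommensuratedAct α Z → (∀ e ∈ E, ∀ᶠ n in atTop, sq α e n ∉ Z) → Z.Finite)
    {τ : X → X} (hτ2 : ∀ x : X, τ (τ x) = x) (hτfix : ∀ x : X, τ x ≠ x)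
    (hnear : ∀ g : A, {x : X | τ (α g x) ≠ α g (τ x)}.Finite)
    (hstar : ∀ g : A, {x : X | α g x = τ x}.Finite)
    (N : ℕ) : ∀ Y : Set X, CommensuratedAct α Y → (∀ x, τ x ∈ Y ↔ x ∈ Y) →
    (ends α E Y).card = N →
    ∃ (n : ℕ) (Xs : Fin (n + 1) → Set X),
      (∀ i, Disjoint (Xs i) (τ '' Xs i)) ∧
      (∀ i j, i ≠ j → Disjoint (Xs i ∪ τ '' Xs i) (Xs j ∪ τ '' Xs j)) ∧
      (⋃ i, (Xs i ∪ τ '' Xs i)) = Y ∧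
      (Xs 0).Finite ∧
      (∀ i : Fin (n + 1), i ≠ 0 → CommensuratedAct α (Xs i) ∧ OneEndedAct α (Xs i)) := by
  induction N using Nat.strong_induction_on with
  | _ N ih =>
    intro Y hY hYτ hN
    by_cases hf : Y.Finite
    · obtain ⟨W, hW1, hW2⟩ := half hτ2 hτfix hYτ
      refine ⟨0, fun _ => W, fun _ => hW1, ?_, ?_, ?_, ?_⟩
      · intro i j hij
        exact absurd (Subsingleton.elim (α := Fin 1) i j) hij
      · simp only [iUnion_const, hW2]
      · exact hf.subset (hW2 ▸ subset_union_left)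
      · intro i hi
        exact absurd (Subsingleton.elim (α := Fin 1) i 0) hi
    · obtain ⟨Z, hZY, hZ, hZ1⟩ := exists_oneEnded hE1 hE2 _ Y hY hf rfl
      have hfin := inter_tau_fin hE1 hE2 hτ2 hnear hstar hZ hZ1
      set V := Z \ τ '' Z with hVdef
      have hmV : ∀ x, x ∈ V ↔ x ∈ Z ∧ τ x ∉ Z := by
        intro x
        simp only [hVdef, Set.mem_sdiff, mem_image_tau hτ2]
      have hV : CommensuratedAct α V := comm_diff hZ (comm_tau hτ2 hnear hZ)
      have hVi : V.Infinite := by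
        intro h
        apply hZ1.1
        refine (h.union hfin).subset ?_
        intro x hx
        by_cases h' : x ∈ τ '' Z
        · exact Or.inr ⟨hx, h'⟩
        · exact Or.inl ⟨hx, h'⟩
      have hV1 : OneEndedAct α V := by
        refine ⟨hVi, fun W hW hWc => ?_⟩
        rcases hZ1.2 W (hW.trans sdiff_subset) hWc with h | h
        · exact Or.inl h
        · exact Or.inr (h.subset (sdiff_subset_sdiff_left sdiff_subset))
      have hVY : V ⊆ Y := sdiff_subset.trans hZY
      have hVd : Disjoint V (τ '' V) := by
        rw [Set.disjoint_left]
        intro x h1 h2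
        rw [mem_image_tau hτ2, hmV] at h2
        rw [hmV] at h1
        exact h1.2 h2.1
      set Y' := (Y \ V) \ τ '' V with hY'
      have hmY' : ∀ x, x ∈ Y' ↔ x ∈ Y ∧ x ∉ V ∧ τ x ∉ V := by
        intro x
        simp only [hY', Set.mem_sdiff, mem_image_tau hτ2]
        tauto
      have hlt : (ends α E Y').card < (ends α E Y).card := by
        refine ends_lt hE1 hE2 hV hVY (sdiff_subset.trans sdiff_subset) ?_ hVi
        exact Disjoint.mono_left sdiff_subset disjoint_sdiff_left
      obtain ⟨n, Xs, h1, h2, h3, h4, h5⟩ := ih _ (hN ▸ hlt) Y'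
        (comm_diff (comm_diff hY hV) (comm_tau hτ2 hnear hV))
        (by
          intro x
          rw [hmY', hmY', hτ2, hYτ]
          tauto) rfl
      have hdis : ∀ i, Disjoint (Xs i ∪ τ '' Xs i) (V ∪ τ '' V) := by
        intro i
        rw [Set.disjoint_left]
        intro x hx hx'
        have : x ∈ Y' := by
          rw [← h3]
          exact mem_iUnion.2 ⟨i, hx⟩
        rw [hmY'] at this
        rw [mem_union, mem_image_tau hτ2] at hx'
        tauto
      refine ⟨n + 1, Fin.snoc (α := fun _ => Set X) Xs V, ?_, ?_, ?_, ?_, ?_⟩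
      · intro i
        induction i using Fin.lastCases with
        | last => simpa using hVd
        | cast i => simpa using h1 i
      · intro i j
        induction i using Fin.lastCases with
        | last =>
          induction j using Fin.lastCases with
          | last => simp
          | cast j =>
            intro _
            simpa only [Fin.snoc_last, Fin.snoc_castSucc] using (hdis j).symm
        | cast i =>
          induction j using Fin.lastCases with
          | last =>
            intro _
            simpa only [Fin.snoc_last, Fin.snoc_castSucc] using hdis i
          | cast j =>
            intro hij
            simpa only [Fin.snoc_castSucc] using h2 i j (fun h => hij (by rw [h]))
      · ext x
        have h3x : (∃ i, x ∈ Xs i ∪ τ '' Xs i) ↔ x ∈ Y' := by rw [← h3, mem_iUnion]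
        rw [mem_iUnion, Fin.exists_fin_succ', ]
        simp only [Fin.snoc_castSucc, Fin.snoc_last]
        rw [h3x, hmY', mem_union, mem_image_tau hτ2]
        constructor
        · rintro (h | h | h)
          · exact h.1
          · exact hVY h
          · exact (hYτ x).1 (hVY h)
        · tauto
      · rw [← Fin.castSucc_zero, Fin.snoc_castSucc]
        exact h4
      · intro i hi
        induction i using Fin.lastCases with
        | last => simpa only [Fin.snoc_last] using ⟨hV, hV1⟩
        | cast i =>
          simp only [Fin.snoc_castSucc]
          exact h5 i (fun h => hi (by rw [h, Fin.castSucc_zero]))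

end Decomp

/-- Decomposition of an action with finitely many orbits of a finitely generated abelian
group along a near-equivariant fixed-point-free involution satisfying condition (∗). -/
theorem decomposition_along_involution
    {A X : Type*} [CommGroup A] [Group.FG A]
    (α : A →* Equiv.Perm X)
    (horb : ∃ T : Finset X, ∀ x : X, ∃ t ∈ T, ∃ g : A, α g t = x)
    (τ : X → X) (hτ2 : ∀ x : X, τ (τ x) = x) (hτfix : ∀ x : X, τ x ≠ x)
    (hnear : ∀ g : A, {x : X | τ (α g x) ≠ α g (τ x)}.Finite)
    (hstar : ∀ g : A, {x : X | α g x = τ x}.Finite) :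
    ∃ (n : ℕ) (Xs : Fin (n + 1) → Set X),
      (Pairwise fun p q : Fin (n + 1) × Bool =>
        Disjoint (if p.2 then τ '' Xs p.1 else Xs p.1)
                 (if q.2 then τ '' Xs q.1 else Xs q.1)) ∧
      (⋃ p : Fin (n + 1) × Bool, (if p.2 then τ '' Xs p.1 else Xs p.1)) = Set.univ ∧
      (Xs 0).Finite ∧
      (∀ i : Fin (n + 1), i ≠ 0 → CommensuratedAct α (Xs i) ∧ OneEndedAct α (Xs i)) := by
  obtain ⟨E, hE1, hE2⟩ := Decomp.exists_ends horb
  obtain ⟨n, Xs, h1, h2, h3, h4, h5⟩ := Decomp.main hE1 hE2 hτ2 hτfix hnear hstar _ Set.univ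
    (by
      rw [Decomp.comm_iff]
      intro g
      simp) (by simp) rfl
  refine ⟨n, Xs, ?_, ?_, h4, h5⟩
  · have hs : ∀ p : Fin (n + 1) × Bool,
        (if p.2 then τ '' Xs p.1 else Xs p.1) ⊆ Xs p.1 ∪ τ '' Xs p.1 := by
      intro p
      split_ifs
      · exact subset_union_right
      · exact subset_union_left
    intro p q hpq
    by_cases hi : p.1 = q.1
    · obtain ⟨i, b⟩ := p
      obtain ⟨j, c⟩ := q
      simp only at hi
      subst hi
      cases b <;> cases c
      · exact absurd rfl hpq
      · simpa using h1 i
      · simpa using (h1 i).symm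
      · exact absurd rfl hpq
    · exact (h2 _ _ hi).mono (hs p) (hs q)
  · rw [Set.eq_univ_iff_forall] at h3 ⊢
    intro x
    obtain ⟨i, hi | hi⟩ := mem_iUnion.1 (h3 x)
    · exact mem_iUnion.2 ⟨(i, false), by simpa using hi⟩
    · exact mem_iUnion.2 ⟨(i, true), by simpa using hi⟩
end

section
/- Let A be a finitely generated abelian group acting on a set X. Let τ : X → X satisfy τ ∘ τ = id and τ(x) ≠ x for all x ∈ X, suppose that for every g ∈ A the set {x ∈ X : τ(g·x) ≠ g·τ(x)} is finite (near equivariance), and that for every g ∈ A the set {x ∈ X : g·x = τ(x)} is finite (condition (∗)). Let f : X → Y be a surjection onto a set Y such that f⁻¹({f(x)}) = {x, τ(x)} for every x ∈ X. Then there exists a group homomorphism β : A → Sym(Y) such that for every g ∈ A the set {x ∈ X : β(g)(f(x)) ≠ f(g·x)} is finite; in other words, the near action of A induced on Y is realizable. -/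
open Set

theorem color_one {Q : Type*} (σ : Q → Q) (h2 : ∀ q, σ (σ q) = q) (hf : ∀ q, σ q ≠ q) :
    ∃ c : Q → Prop, ∀ q, (c (σ q) ↔ ¬ c q) := by
  classical
  let _ : LinearOrder Q := linearOrderOfSTO WellOrderingRel
  refine ⟨fun q => q < σ q, fun q => ?_⟩
  simp only [h2, not_lt]
  exact ⟨fun h => h.le, fun h => lt_of_le_of_ne h (hf q)⟩

theorem color_two {Q : Type*} (σ ρ : Q → Q) (h2 : ∀ q, σ (σ q) = q) (hf : ∀ q, σ q ≠ q)
    (k2 : ∀ q, ρ (ρ q) = q) (kf : ∀ q, ρ q ≠ q) :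
    ∃ c : Q → Prop, ∀ q, (c (σ q) ↔ ¬ c q) ∧ (c (ρ q) ↔ ¬ c q) := by
  classical
  let s : Equiv.Perm Q := ⟨σ, σ, h2, h2⟩
  let r : Equiv.Perm Q := ⟨ρ, ρ, k2, k2⟩
  let p : Equiv.Perm Q := r * s
  have hss : s * s = 1 := by ext q; exact h2 q
  have hrr : r * r = 1 := by ext q; exact k2 q
  have hsi : s⁻¹ = s := inv_eq_of_mul_eq_one_left hss
  have hri : r⁻¹ = r := inv_eq_of_mul_eq_one_left hrr
  have hr : r = p * s := by simp only [p, mul_assoc, hss, mul_one]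
  have hconj : s * p * s⁻¹ = p⁻¹ := by
    simp only [p, mul_inv_rev, hsi, hri, mul_assoc, hss, mul_one]
  have hk : ∀ k : ℤ, s * p ^ k = p ^ (-k) * s := by
    intro k
    have : s * p ^ k * s⁻¹ = p ^ (-k) := by
      rw [← conj_zpow, hconj, inv_zpow, zpow_neg]
    rw [← this]; group
  have hk' : ∀ (k : ℤ) (q : Q), s ((p ^ k) q) = (p ^ (-k)) (s q) := by
    intro k q
    have := congrArg (fun e : Equiv.Perm Q => e q) (hk k)
    simpa using this
  have hns : ∀ q, ¬ p.SameCycle q (s q) := by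
    rintro q ⟨k, hkq⟩
    rcases Int.even_or_odd' k with ⟨j, rfl | rfl⟩
    · apply hf ((p ^ j) q)
      change s _ = _
      rw [hk', ← hkq, ← Equiv.Perm.mul_apply, ← zpow_add]
      congr 2; ring
    · apply kf ((p ^ (j+1)) q)
      change r _ = _
      rw [hr, Equiv.Perm.mul_apply, hk', ← hkq, ← Equiv.Perm.mul_apply, ← zpow_one_add,
        ← Equiv.Perm.mul_apply, ← zpow_add]
      congr 2; ring
  let S := Equiv.Perm.SameCycle.setoid p
  have hmap : ∀ x y, p.SameCycle x y → p.SameCycle (s x) (s y) := by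
    rintro x y ⟨k, rfl⟩
    exact ⟨-k, (hk' k x).symm⟩
  obtain ⟨c, hc⟩ := color_one (Q := Quotient S) (Quotient.map s hmap)
    (by rintro ⟨q⟩; exact congrArg (Quotient.mk S) (h2 q))
    (by
      rintro ⟨q⟩ h
      exact hns q (Quotient.exact h).symm)
  refine ⟨fun q => c (Quotient.mk S q), fun q => ⟨hc (Quotient.mk S q), ?_⟩⟩
  have : Quotient.mk S (ρ q) = Quotient.mk S (s q) := by
    apply Quotient.sound
    refine Equiv.Perm.SameCycle.symm ⟨1, ?_⟩
    change (p ^ (1:ℤ)) (s q) = r q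
    rw [hr]; simp
  change c (Quotient.mk S (ρ q)) ↔ _
  rw [this]
  exact hc (Quotient.mk S q)

section
variable {A X : Type*} [CommGroup A] [MulAction A X]

/-- points on which `a` acts with infinite order -/
def infPts (a : A) (x : X) : Prop := ∀ n : ℕ, 0 < n → a ^ n • x ≠ x

theorem infPts.inv {a : A} {x : X} (h : infPts a x) : infPts a⁻¹ x := by
  intro n hn e
  apply h n hn
  rw [inv_pow, inv_smul_eq_iff] at e
  exact e.symm

theorem infPts.smul {a : A} {x : X} (h : infPts a x) (g : A) : infPts a (g • x) := by
  intro n hn e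
  apply h n hn
  rw [smul_comm] at e
  exact smul_left_cancel g e

theorem infPts.inj {a : A} {x : X} (h : infPts a x) :
    Function.Injective (fun n : ℕ => a ^ n • x) := by
  have key : ∀ m k : ℕ, a ^ m • x = a ^ (m + k) • x → k = 0 := by
    intro m k e
    by_contra hk
    rw [pow_add, mul_smul] at e
    exact h k (Nat.pos_of_ne_zero hk) (smul_left_cancel _ e).symm
  intro m n e
  rcases le_total m n with hmn | hmn
  · obtain ⟨k, rfl⟩ := Nat.exists_eq_add_of_le hmn
    have := key m k e
    omega
  · obtain ⟨k, rfl⟩ := Nat.exists_eq_add_of_le hmn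
    have := key n k e.symm
    omega

theorem infPts.ev {a : A} {x : X} (h : infPts a x) {S : Set X} (hS : S.Finite) :
    ∀ᶠ n : ℕ in Filter.atTop, a ^ n • x ∉ S := by
  have : {n : ℕ | a ^ n • x ∈ S}.Finite := hS.preimage h.inj.injOn
  rw [← Nat.cofinite_eq_atTop]
  exact this.eventually_cofinite_notMem

variable (τ : X → X) (hτ2 : ∀ x : X, τ (τ x) = x)
    (hnear : ∀ g : A, {x : X | τ (g • x) ≠ g • (τ x)}.Finite)
    (hstar : ∀ g : A, {x : X | g • x = τ x}.Finite)

include hnear in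
theorem exists_lim {a : A} {x : X} (h : infPts a x) :
    ∃ z : X, ∀ᶠ n : ℕ in Filter.atTop, τ (a ^ n • x) = a ^ n • z := by
  obtain ⟨N, hN⟩ := Filter.eventually_atTop.1 (h.ev (hnear a))
  refine ⟨(a ^ N)⁻¹ • τ (a ^ N • x), Filter.eventually_atTop.2 ⟨N, fun n hn => ?_⟩⟩
  induction n, hn using Nat.le_induction with
  | base => rw [smul_inv_smul]
  | succ n hn ih =>
    have := hN n hn
    simp only [mem_ofPred_eq, not_not] at this
    rw [pow_succ', mul_smul, this, ih, mul_smul]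

include hτ2 hnear hstar in
theorem exists_T (a : A) : ∃ T : X → X, ∀ x, infPts a x →
    infPts a (T x) ∧ (∀ g : A, T (g • x) = g • T x) ∧ T (T x) = x ∧ (∀ g : A, T x ≠ g • x) ∧
    ((∀ n : ℕ, τ (a • a ^ n • x) = a • τ (a ^ n • x)) → τ x = T x) := by
  classical
  have : ∀ x : X, ∃ z, infPts a x → ∀ᶠ n : ℕ in Filter.atTop, τ (a ^ n • x) = a ^ n • z := by
    intro x
    by_cases h : infPts a x
    · obtain ⟨z, hz⟩ := exists_lim τ hnear h
      exact ⟨z, fun _ => hz⟩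
    · exact ⟨x, fun h' => absurd h' h⟩
  choose T hT using this
  have hinj : Function.Injective τ := fun x y e => by rw [← hτ2 x, e, hτ2]
  have hinf : ∀ x, infPts a x → infPts a (T x) := by
    intro x h m hm e
    have h1 := hT x h
    have h2 := (Filter.tendsto_add_atTop_nat m).eventually h1
    obtain ⟨n, e1, e2⟩ := (h1.and h2).exists
    rw [pow_add, mul_smul, mul_smul, e, ← e1] at e2
    exact h m hm (smul_left_cancel _ (hinj e2))
  refine ⟨T, fun x h => ⟨hinf x h, ?_, ?_, ?_, ?_⟩⟩
  · intro g
    obtain ⟨n, ⟨e1, e2⟩, e3⟩ := (((hT x h).and (hT _ (h.smul g))).and (h.ev (hnear g))).exists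
    simp only [mem_ofPred_eq, not_not] at e3
    apply smul_left_cancel (a ^ n)
    rw [← e2, smul_comm, e3, e1, smul_comm]
  · obtain ⟨n, e1, e2⟩ := ((hT x h).and (hT _ (hinf x h))).exists
    apply smul_left_cancel (a ^ n)
    rw [← e2, ← e1, hτ2]
  · intro g e
    obtain ⟨n, e1, e2⟩ := ((hT x h).and (h.ev (hstar g))).exists
    apply e2
    simp only [mem_ofPred_eq]
    rw [e1, e, smul_comm]
  · intro hx
    have : ∀ n : ℕ, τ (a ^ n • x) = a ^ n • τ x := by
      intro n
      induction n with
      | zero => simp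
      | succ n ih => rw [pow_succ', mul_smul, hx, ih, mul_smul]
    obtain ⟨n, e1⟩ := (hT x h).exists
    apply smul_left_cancel (a ^ n)
    rw [← e1, this]

/-- the invariant subset of points of infinite order -/
def infSub (a : A) : SubMulAction A X where
  carrier := {x | infPts a x}
  smul_mem' g _ h := infPts.smul h g

theorem infPts.zpow_ne {a : A} {x : X} (h : infPts a x) {n : ℤ} (hn : n ≠ 0) :
    a ^ n • x ≠ x := by
  rcases Int.eq_nat_or_neg n with ⟨m, rfl | rfl⟩
  · rw [zpow_natCast]; exact h m (by omega)
  · rw [zpow_neg, zpow_natCast, ← inv_pow]; exact h.inv m (by omega)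

theorem two_rays (a : A) {E : Set X} (hE : E.Finite) :
    {x : X | infPts a x ∧ (∃ n : ℕ, a ^ n • x ∈ E) ∧ ∃ n : ℕ, a⁻¹ ^ n • x ∈ E}.Finite := by
  classical
  have key : ∀ e ∈ E, ∀ e' ∈ E, {x : X | infPts a x ∧ (∃ n : ℕ, a ^ n • x = e) ∧
      ∃ n : ℕ, a⁻¹ ^ n • x = e'}.Finite := by
    intro e _ e' _
    by_cases hk : ∃ k : ℕ, infPts a e' ∧ e = a ^ k • e'
    · obtain ⟨k, hi, hk⟩ := hk
      apply (Set.finite_range (fun i : Fin (k+1) => a ^ (i : ℕ) • e')).subset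
      rintro x ⟨hx, ⟨n, hn⟩, ⟨m, hm⟩⟩
      rw [inv_pow, inv_smul_eq_iff] at hm
      have : n + m = k := by
        apply hi.inj
        simp only
        rw [← hk, ← hn, hm, smul_smul, pow_add]
      exact ⟨⟨m, by omega⟩, hm.symm⟩
    · convert Set.finite_empty
      rw [Set.eq_empty_iff_forall_notMem]
      rintro x ⟨hx, ⟨n, hn⟩, ⟨m, hm⟩⟩
      apply hk
      refine ⟨n + m, hm ▸ hx.smul _, ?_⟩
      rw [inv_pow, inv_smul_eq_iff] at hm
      rw [← hn, hm, smul_smul, pow_add]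
  apply (hE.biUnion fun e he => hE.biUnion fun e' he' => key e he e' he').subset
  rintro x ⟨hx, ⟨n, hn⟩, ⟨m, hm⟩⟩
  simp only [mem_iUnion]
  exact ⟨_, hn, _, hm, hx, ⟨n, rfl⟩, ⟨m, rfl⟩⟩

include hτ2 hnear hstar in
theorem exists_W (a : A) : ∃ W : X → Prop, (∀ (g : A) x, W (g • x) ↔ W x) ∧
    {x | infPts a x ∧ (W (τ x) ↔ W x)}.Finite := by
  classical
  obtain ⟨T, hT⟩ := exists_T τ hτ2 hnear hstar a
  obtain ⟨U, hU'⟩ := exists_T τ hτ2 hnear hstar a⁻¹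
  have hU : ∀ x, infPts a x → infPts a (U x) ∧ _ := fun x h =>
    ⟨by simpa using (hU' x h.inv).1.inv, (hU' x h.inv).2⟩
  clear hU'
  let Q := MulAction.orbitRel.Quotient A (infSub (X := X) a)
  have mk : ∀ V : X → X, (∀ x, infPts a x → infPts a (V x) ∧ (∀ g : A, V (g • x) = g • V x) ∧
      V (V x) = x ∧ (∀ g : A, V x ≠ g • x)) → ∃ σ : Q → Q, (∀ q, σ (σ q) = q) ∧ (∀ q, σ q ≠ q) ∧
      ∀ x (h : infPts a x) (h' : infPts a (V x)),
        σ (Quotient.mk _ ⟨x, h⟩) = Quotient.mk _ ⟨V x, h'⟩ := by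
    intro V hV
    refine ⟨Quotient.map (fun x => ⟨V x.1, (hV x.1 x.2).1⟩) ?_, ?_, ?_, ?_⟩
    · rintro x y ⟨g, rfl⟩
      exact ⟨g, Subtype.ext ((hV y.1 y.2).2.1 g).symm⟩
    · rintro ⟨x⟩
      exact congrArg (Quotient.mk _) (Subtype.ext (hV x.1 x.2).2.2.1)
    · rintro ⟨x⟩ h
      obtain ⟨g, hg⟩ := Quotient.exact h
      exact (hV x.1 x.2).2.2.2 g (congrArg Subtype.val hg).symm
    · intro x h h'
      rfl
  obtain ⟨σ, s2, sf, hs⟩ := mk T fun x h => ⟨(hT x h).1, (hT x h).2.1, (hT x h).2.2.1, (hT x h).2.2.2.1⟩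
  obtain ⟨ρ, r2, rf, hr⟩ := mk U fun x h => ⟨(hU x h).1, (hU x h).2.1, (hU x h).2.2.1, (hU x h).2.2.2.1⟩
  obtain ⟨c, hc⟩ := color_two σ ρ s2 sf r2 rf
  let W : X → Prop := fun x => ∃ h : infPts a x, c (Quotient.mk _ ⟨x, h⟩)
  have hWc : ∀ x (h : infPts a x), W x ↔ c (Quotient.mk _ ⟨x, h⟩) := fun x h =>
    ⟨fun ⟨_, h'⟩ => h', fun h' => ⟨h, h'⟩⟩
  refine ⟨W, ?_, ?_⟩
  · have : ∀ (g : A) x, W x → W (g • x) := by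
      rintro g x ⟨h, h'⟩
      refine ⟨h.smul g, ?_⟩
      convert h' using 1
      exact Quotient.sound ⟨g, rfl⟩
    intro g x
    refine ⟨fun h => ?_, this g x⟩
    have := this g⁻¹ _ h
    rwa [inv_smul_smul] at this
  · apply (two_rays a ((hnear a).union (hnear a⁻¹))).subset
    rintro x ⟨hx, hW⟩
    refine ⟨hx, ?_, ?_⟩
    · by_contra! hcon
      have := (hT x hx).2.2.2.2 (fun n => by
        have := hcon n
        simp only [mem_union, mem_ofPred_eq, not_or, not_not] at this
        exact this.1)
      rw [this, hWc _ (hT x hx).1, hWc _ hx, ← hs x hx, (hc _).1] at hW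
      tauto
    · by_contra! hcon
      have := (hU x hx).2.2.2.2 (fun n => by
        have := hcon n
        simp only [mem_union, mem_ofPred_eq, not_or, not_not] at this
        exact this.2)
      rw [this, hWc _ (hU x hx).1, hWc _ hx, ← hr x hx, (hc _).2] at hW
      tauto

/-- elements having a positive power in `H` -/
def radSub (H : Subgroup A) : Subgroup A where
  carrier := {a | ∃ n : ℕ, 0 < n ∧ a ^ n ∈ H}
  one_mem' := ⟨1, one_pos, by simp⟩
  mul_mem' := by
    rintro a b ⟨n, hn, ha⟩ ⟨m, hm, hb⟩
    refine ⟨n * m, Nat.mul_pos hn hm, ?_⟩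
    rw [mul_pow, pow_mul, mul_comm n m, pow_mul b]
    exact H.mul_mem (H.pow_mem ha _) (H.pow_mem hb _)
  inv_mem' := by
    rintro a ⟨n, hn, ha⟩
    exact ⟨n, hn, by rw [inv_pow]; exact H.inv_mem ha⟩

theorem finite_of_rad [Group.FG A] (H : Subgroup A) (h : (radSub H).FiniteIndex) :
    Finite (A ⧸ H) := by
  have : Group.FG (A ⧸ H) := inferInstance
  refine CommGroup.finite_of_fg_isMulTorsion _ ?_
  intro b
  obtain ⟨a, rfl⟩ := QuotientGroup.mk_surjective b
  obtain ⟨n, hn, -, m, hm, e⟩ := Subgroup.exists_pow_mem_of_index_ne_zero h.index_ne_zero a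
  rw [isOfFinOrder_iff_pow_eq_one]
  refine ⟨n * m, Nat.mul_pos hn hm, ?_⟩
  rw [← pow_mul] at e
  exact (QuotientGroup.eq_one_iff _).2 e

open scoped Pointwise in
theorem exists_a [Group.FG A] [Finite (MulAction.orbitRel.Quotient A X)] :
    ∃ a : A, {x : X | ¬ infPts a x}.Finite := by
  classical
  have := Fintype.ofFinite (MulAction.orbitRel.Quotient A X)
  let rep : MulAction.orbitRel.Quotient A X → X := Quotient.out
  let s : Finset (MulAction.orbitRel.Quotient A X) :=
    Finset.univ.filter fun q => ¬ (MulAction.orbit A (rep q)).Finite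
  have hne : (⋃ q ∈ s, (1 : A) • (radSub (MulAction.stabilizer A (rep q)) : Set A)) ≠ univ := by
    intro h
    obtain ⟨q, hq, hfi⟩ := Subgroup.exists_finiteIndex_of_leftCoset_cover h
    have := finite_of_rad _ hfi
    apply (Finset.mem_filter.1 hq).2
    have := Finite.of_equiv _ (MulAction.orbitEquivQuotientStabilizer A (rep q)).symm
    exact Set.toFinite _
  obtain ⟨a, ha⟩ := (Set.ne_univ_iff_exists_notMem _).1 hne
  simp only [one_smul, mem_iUnion, not_exists] at ha
  refine ⟨a, ?_⟩
  have hf : (⋃ q ∈ {q | (MulAction.orbit A (rep q)).Finite}, MulAction.orbit A (rep q)).Finite :=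
    Set.Finite.biUnion (Set.toFinite _) fun q hq => hq
  apply hf.subset
  intro x hx
  simp only [mem_iUnion]
  let q : MulAction.orbitRel.Quotient A X := Quotient.mk _ x
  have hxq : x ∈ MulAction.orbit A (rep q) := by
    have : (MulAction.orbitRel A X) (rep q) x := Quotient.exact (Quotient.out_eq q)
    exact (MulAction.orbitRel A X).symm this
  refine ⟨q, ?_, hxq⟩
  by_contra hq
  apply ha q (Finset.mem_filter.2 ⟨Finset.mem_univ _, hq⟩)
  simp only [mem_ofPred_eq, infPts] at hx
  push Not at hx
  obtain ⟨n, hn, e⟩ := hx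
  obtain ⟨g, hg⟩ := hxq
  refine ⟨n, hn, ?_⟩
  rw [MulAction.mem_stabilizer_iff]
  simp only at hg
  rw [← hg] at e
  rw [smul_comm] at e
  exact smul_left_cancel g e

end

section
variable {A X Y : Type*} [CommGroup A] [MulAction A X]

theorem realize_of_W_aux (τ : X → X) (hτ2 : ∀ x : X, τ (τ x) = x) (hτfix : ∀ x : X, τ x ≠ x)
    (hnear : ∀ g : A, {x : X | τ (g • x) ≠ g • (τ x)}.Finite)
    (f : X → Y) (hsurj : Function.Surjective f)
    (hfib : ∀ x z : X, f z = f x ↔ z = x ∨ z = τ x)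
    (W : X → Prop) (hW : ∀ (g : A) x, W (g • x) ↔ W x) (hD : {x | W (τ x) ↔ W x}.Finite)
    (hle : {y : Y | ∀ x, f x = y → W x}.ncard ≤ {y : Y | ∀ x, f x = y → ¬ W x}.ncard) :
    ∃ β : A →* Equiv.Perm Y, ∀ g : A, {x : X | β g (f x) ≠ f (g • x)}.Finite := by
  classical
  have hfτ : ∀ x, f (τ x) = f x := fun x => (hfib x (τ x)).2 (Or.inr rfl)
  have hinj : Function.Injective τ := fun x y e => by rw [← hτ2 x, e, hτ2]
  set N2 := {y : Y | ∀ x, f x = y → W x} with hN2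
  set N0 := {y : Y | ∀ x, f x = y → ¬ W x} with hN0
  have hN2f : N2.Finite := by
    apply (hD.image f).subset
    intro y hy
    obtain ⟨x, rfl⟩ := hsurj y
    exact ⟨x, iff_of_true (hy _ (hfτ x)) (hy _ rfl), rfl⟩
  have hN0f : N0.Finite := by
    apply (hD.image f).subset
    intro y hy
    obtain ⟨x, rfl⟩ := hsurj y
    exact ⟨x, iff_of_false (hy _ (hfτ x)) (hy _ rfl), rfl⟩
  obtain ⟨j, hjm, hji⟩ : ∃ j : Y → Y, (∀ y ∈ N2, j y ∈ N0) ∧ InjOn j N2 := by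
    by_cases hY : Nonempty Y
    · have := hN2f.fintype
      have hle' : N2.encard ≤ N0.encard := by
        rw [← hN2f.cast_ncard_eq, ← hN0f.cast_ncard_eq]
        exact_mod_cast hle
      obtain ⟨j, h1, h2⟩ := hN2f.exists_injOn_of_encard_le hle'
      exact ⟨j, fun y hy => h1 hy, h2⟩
    · exact ⟨id, fun y => absurd ⟨y⟩ hY, fun y => absurd ⟨y⟩ hY⟩
  choose s hs using hsurj
  let WS : SubMulAction A X := ⟨{x | W x}, fun g x h => (hW g x).2 h⟩
  let h0 : X → Y := fun x => if x = s (f x) ∨ ¬ W (τ x) then f x else j (f x)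
  have hmem : ∀ x, W x → W (τ x) → f x ∈ N2 := by
    intro x h1 h2 z hz
    rcases (hfib x z).1 hz with rfl | rfl
    · exact h1
    · exact h2
  have hh0 : ∀ x, W x → ∀ z, W z → h0 x = h0 z → x = z := by
    intro x hx z hz e
    have hnN0 : ∀ x z, W x → W z → ¬ (z = s (f z) ∨ ¬ W (τ z)) → f x ≠ j (f z) := by
      intro x z hx hz hcz e
      push Not at hcz
      have := hjm _ (hmem z hz hcz.2)
      rw [← e] at this
      exact this x rfl hx
    by_cases cx : x = s (f x) ∨ ¬ W (τ x) <;> by_cases cz : z = s (f z) ∨ ¬ W (τ z)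
    · simp only [h0, if_pos cx, if_pos cz] at e
      rcases (hfib z x).1 e with rfl | h
      · rfl
      · have h' : z = τ x := by rw [h, hτ2]
        rcases cx with cx | cx
        · rcases cz with cz | cz
          · rw [cx, cz, e]
          · exact absurd (h ▸ hx) cz
        · exact absurd (h' ▸ hz) cx
    · simp only [h0, if_pos cx, if_neg cz] at e
      exact absurd e (hnN0 x z hx hz cz)
    · simp only [h0, if_neg cx, if_pos cz] at e
      exact absurd e.symm (hnN0 z x hz hx cx)
    · simp only [h0, if_neg cx, if_neg cz] at e
      push Not at cx cz
      have e := hji (hmem x hx cx.2) (hmem z hz cz.2) e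
      rcases (hfib z x).1 e with h | h
      · exact h
      · exfalso
        have h3 := (hfib z (s (f z))).1 (hs _)
        rcases h3 with h3 | h3
        · exact cz.1 h3.symm
        · apply cx.1; rw [e, h3, h]
  let ι : WS ↪ Y := ⟨fun x => h0 x.1, fun x z e => Subtype.ext (hh0 x.1 x.2 z.1 z.2 e)⟩
  refine ⟨(Equiv.Perm.viaEmbeddingHom ι).comp (MulAction.toPermHom A WS), fun g => ?_⟩
  set β := (Equiv.Perm.viaEmbeddingHom ι).comp (MulAction.toPermHom A WS) with hβ
  set D := {x | W (τ x) ↔ W x} with hDdef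
  have hh : ∀ x, W x → x ∉ D → h0 x = f x := by
    intro x hx hxD
    have : ¬ W (τ x) := fun h => hxD (iff_of_true h hx)
    simp only [h0, if_pos (Or.inr this : x = s (f x) ∨ ¬ W (τ x))]
  have main : ∀ x, W x → x ∉ D → g • x ∉ D → β g (f x) = f (g • x) := by
    intro x hx h1 h2
    rw [← hh x hx h1, ← hh _ ((hW g x).2 hx) h2]
    exact Equiv.Perm.viaEmbedding_apply (MulAction.toPerm g) ι ⟨x, hx⟩
  have hgD : {x | g • x ∈ D}.Finite := hD.preimage (MulAction.injective g).injOn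
  have hgD' : {x | g • τ x ∈ D}.Finite :=
    hD.preimage ((MulAction.injective g).comp hinj).injOn
  apply (((hD.union hgD).union hgD').union (hnear g)).subset
  intro x hx
  by_contra hcon
  simp only [mem_union, mem_ofPred_eq, not_or, not_not] at hcon hx
  obtain ⟨⟨⟨c1, c2⟩, c3⟩, c4⟩ := hcon
  by_cases hWx : W x
  · exact hx (main x hWx c1 c2)
  · have hτx : W (τ x) := by
      by_contra h
      exact c1 (iff_of_false h hWx)
    have hτD : τ x ∉ D := by
      intro h
      simp only [D, mem_ofPred_eq, hτ2] at h
      exact hWx (h.2 hτx)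
    apply hx
    rw [← hfτ x, main _ hτx hτD c3, ← c4, hfτ]

theorem realize_of_W (τ : X → X) (hτ2 : ∀ x : X, τ (τ x) = x) (hτfix : ∀ x : X, τ x ≠ x)
    (hnear : ∀ g : A, {x : X | τ (g • x) ≠ g • (τ x)}.Finite)
    (f : X → Y) (hsurj : Function.Surjective f)
    (hfib : ∀ x z : X, f z = f x ↔ z = x ∨ z = τ x)
    (W : X → Prop) (hW : ∀ (g : A) x, W (g • x) ↔ W x) (hD : {x | W (τ x) ↔ W x}.Finite) :
    ∃ β : A →* Equiv.Perm Y, ∀ g : A, {x : X | β g (f x) ≠ f (g • x)}.Finite := by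
  rcases le_total {y : Y | ∀ x, f x = y → W x}.ncard {y : Y | ∀ x, f x = y → ¬ W x}.ncard with h | h
  · exact realize_of_W_aux τ hτ2 hτfix hnear f hsurj hfib W hW hD h
  · refine realize_of_W_aux τ hτ2 hτfix hnear f hsurj hfib (fun x => ¬ W x)
      (fun g x => not_congr (hW g x)) ?_ ?_
    · simpa only [not_iff_not] using hD
    · simpa only [not_not] using h

theorem realize_finite_orbits [Group.FG A] [Finite (MulAction.orbitRel.Quotient A X)]
    (τ : X → X) (hτ2 : ∀ x : X, τ (τ x) = x) (hτfix : ∀ x : X, τ x ≠ x)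
    (hnear : ∀ g : A, {x : X | τ (g • x) ≠ g • (τ x)}.Finite)
    (hstar : ∀ g : A, {x : X | g • x = τ x}.Finite)
    (f : X → Y) (hsurj : Function.Surjective f)
    (hfib : ∀ x z : X, f z = f x ↔ z = x ∨ z = τ x) :
    ∃ β : A →* Equiv.Perm Y, ∀ g : A, {x : X | β g (f x) ≠ f (g • x)}.Finite := by
  obtain ⟨a, ha⟩ := exists_a (A := A) (X := X)
  obtain ⟨W, hW, hD⟩ := exists_W τ hτ2 hnear hstar a
  refine realize_of_W τ hτ2 hτfix hnear f hsurj hfib W hW ((ha.union hD).subset ?_)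
  intro x hx
  by_cases h : infPts a x
  · exact Or.inr ⟨h, hx⟩
  · exact Or.inl h

theorem realize_general [Group.FG A]
    (τ : X → X) (hτ2 : ∀ x : X, τ (τ x) = x) (hτfix : ∀ x : X, τ x ≠ x)
    (hnear : ∀ g : A, {x : X | τ (g • x) ≠ g • (τ x)}.Finite)
    (hstar : ∀ g : A, {x : X | g • x = τ x}.Finite)
    (f : X → Y) (hsurj : Function.Surjective f)
    (hfib : ∀ x z : X, f z = f x ↔ z = x ∨ z = τ x) :
    ∃ β : A →* Equiv.Perm Y, ∀ g : A, {x : X | β g (f x) ≠ f (g • x)}.Finite := by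
  classical
  have hfτ : ∀ x, f (τ x) = f x := fun x => (hfib x (τ x)).2 (Or.inr rfl)
  obtain ⟨S, hS, hSf⟩ := Group.fg_iff.1 (inferInstance : Group.FG A)
  let E : Set X := ⋃ g ∈ S, {x : X | τ (g • x) ≠ g • (τ x)}
  have hE : E.Finite := hSf.biUnion fun g _ => hnear g
  have hEτ : ∀ x, τ x ∈ E → x ∈ E := by
    intro x hx
    simp only [E, mem_iUnion, mem_ofPred_eq] at hx ⊢
    obtain ⟨g, hg, h⟩ := hx
    refine ⟨g, hg, fun e => h ?_⟩
    rw [hτ2, ← e, hτ2]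
  let B : SubMulAction A X := ⟨{x | ∃ g : A, g • x ∈ E}, by
    rintro g x ⟨k, hk⟩
    exact ⟨k * g⁻¹, by rwa [mul_smul, inv_smul_smul]⟩⟩
  have hBg : ∀ (g : A) x, g • x ∈ B ↔ x ∈ B := fun g x =>
    ⟨fun h => by simpa using B.smul_mem g⁻¹ h, fun h => B.smul_mem g h⟩
  have hgood : ∀ (g : A) x, x ∉ B → τ (g • x) = g • τ x := by
    intro g
    have hg : g ∈ Subgroup.closure S := hS ▸ Subgroup.mem_top g
    induction hg using Subgroup.closure_induction with
    | mem g hg =>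
      intro x hx
      by_contra h
      apply hx
      refine ⟨1, ?_⟩
      rw [one_smul]
      exact mem_biUnion hg h
    | one => intro x _; simp
    | mul g k _ _ h1 h2 =>
      intro x hx
      rw [mul_smul, h1 _ (by rwa [hBg]), h2 _ hx, mul_smul]
    | inv g _ h1 =>
      intro x hx
      have := h1 (g⁻¹ • x) (by rwa [hBg])
      rw [smul_inv_smul] at this
      rw [this, inv_smul_smul]
  have hBτ : ∀ x, τ x ∈ B → x ∈ B := by
    intro x hx
    by_contra h
    obtain ⟨g, hg⟩ := hx
    apply h
    refine ⟨g, hEτ _ ?_⟩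
    rwa [hgood g x h]
  have hBτ' : ∀ x, x ∈ B → τ x ∈ B := fun x hx => hBτ _ (by rwa [hτ2])
  have hBf : ∀ x z, f z = f x → x ∈ B → z ∈ B := by
    intro x z e hx
    rcases (hfib x z).1 e with rfl | rfl
    · exact hx
    · exact hBτ' x hx
  have hfin : Finite (MulAction.orbitRel.Quotient A B) := by
    have := hE.to_subtype
    let φ : E → MulAction.orbitRel.Quotient A B := fun x =>
      Quotient.mk _ ⟨x.1, 1, by rw [one_smul]; exact x.2⟩
    apply Finite.of_surjective φ
    rintro ⟨⟨x, g, hg⟩⟩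
    refine ⟨⟨g • x, hg⟩, Quotient.sound ⟨g, rfl⟩⟩
  let p : Y → Prop := fun y => ∃ x ∈ B, f x = y
  have hpf : ∀ x, p (f x) ↔ x ∈ B := fun x =>
    ⟨fun ⟨z, hz, e⟩ => hBf z x e.symm hz, fun h => ⟨x, h, rfl⟩⟩
  obtain ⟨β₁, h₁⟩ := realize_finite_orbits (A := A) (X := B) (Y := {y // p y})
    (fun x => ⟨τ x.1, hBτ' _ x.2⟩) (fun x => Subtype.ext (hτ2 _))
    (fun x e => hτfix x.1 (congrArg Subtype.val e))
    (fun g => by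
      apply ((hnear g).preimage (f := fun x : B => x.1) Subtype.val_injective.injOn).subset
      intro x hx e
      exact hx (Subtype.ext e))
    (fun g => by
      apply ((hstar g).preimage (f := fun x : B => x.1) Subtype.val_injective.injOn).subset
      intro x hx
      exact congrArg Subtype.val hx)
    (fun x => ⟨f x.1, x.1, x.2, rfl⟩)
    (by
      rintro ⟨y, x, hx, rfl⟩
      exact ⟨⟨x, hx⟩, rfl⟩)
    (fun x z => by
      simp only [Subtype.ext_iff]
      exact hfib x.1 z.1)
  choose s hs using hsurj
  have hdesc : ∀ (g : A) x z, x ∉ B → f z = f x → f (g • z) = f (g • x) := by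
    intro g x z hx e
    rcases (hfib x z).1 e with rfl | rfl
    · rfl
    · rw [← hgood g x hx, hfτ]
  have hsB : ∀ y, ¬ p y → s y ∉ B := by
    intro y hy h
    rw [← hpf, hs] at h
    exact hy h
  let act : MulAction A {y // ¬ p y} :=
    { smul := fun g y => ⟨f (g • s y.1), by rw [hpf, hBg]; exact hsB _ y.2⟩
      one_smul := fun y => Subtype.ext (by
        change f ((1 : A) • s y.1) = y.1
        rw [one_smul, hs])
      mul_smul := fun g k y => Subtype.ext (by
        change f ((g * k) • s y.1) = f (g • s (f (k • s y.1)))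
        rw [mul_smul]
        exact (hdesc g _ _ (by rw [hBg]; exact hsB _ y.2) (hs _)).symm) }
  refine ⟨(Equiv.Perm.subtypeCongrHom p).comp (β₁.prod (MulAction.toPermHom A {y // ¬ p y})),
    fun g => ?_⟩
  apply ((h₁ g).image (fun x : B => x.1)).subset
  intro x hx
  by_cases hxB : x ∈ B
  · refine ⟨⟨x, hxB⟩, fun e => hx ?_, rfl⟩
    have e' := congrArg Subtype.val e
    change Equiv.Perm.subtypeCongr _ _ (f x) = _
    rw [Equiv.Perm.subtypeCongr.left_apply _ _ ((hpf x).2 hxB)]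
    exact e'
  · exfalso
    apply hx
    change Equiv.Perm.subtypeCongr _ _ (f x) = _
    rw [Equiv.Perm.subtypeCongr.right_apply _ _ (fun h => hxB ((hpf x).1 h))]
    change f (g • s (f x)) = _
    exact hdesc g x _ hxB (hs _)

end

/-- The near action induced on the quotient of `X` by a near-equivariant fixed-point-free
involution satisfying condition (∗) is realizable. -/
theorem quotient_by_involution_realizable
    {A X Y : Type*} [CommGroup A] [Group.FG A]
    (α : A →* Equiv.Perm X)
    (τ : X → X) (hτ2 : ∀ x : X, τ (τ x) = x) (hτfix : ∀ x : X, τ x ≠ x)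
    (hnear : ∀ g : A, {x : X | τ (α g x) ≠ α g (τ x)}.Finite)
    (hstar : ∀ g : A, {x : X | α g x = τ x}.Finite)
    (f : X → Y) (hsurj : Function.Surjective f)
    (hfib : ∀ x : X, f ⁻¹' {f x} = {x, τ x}) :
    ∃ β : A →* Equiv.Perm Y, ∀ g : A, {x : X | β g (f x) ≠ f (α g x)}.Finite := by
  let _ : MulAction A X := MulAction.compHom X α
  exact realize_general (A := A) τ hτ2 hτfix hnear hstar f hsurj (fun x z => by
    have : z ∈ f ⁻¹' {f x} ↔ z ∈ ({x, τ x} : Set X) := by rw [hfib]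
    simpa using this)
end

section
/- Let A be a finitely generated abelian group acting on a set X with finitely many orbits. Let τ : X → X satisfy τ ∘ τ = id and τ(x) ≠ x for all x ∈ X, suppose that for every g ∈ A the set {x ∈ X : τ(g·x) ≠ g·τ(x)} is finite (near equivariance), and that for every g ∈ A the set {x ∈ X : g·x = τ(x)} is finite (condition (∗)). Let f : X → Y be a surjection onto a set Y with f⁻¹({f(x)}) = {x, τ(x)} for every x ∈ X. Then there exists a subset U ⊆ X such that U ∩ τ(U) = ∅, U ∪ τ(U) = X, and U is A-commensurated (for every g ∈ A, the symmetric difference (g·U) Δ U is finite); consequently f restricted to U is a bijection from U onto Y. (This expresses that X is balanceably near isomorphic to the disjoint union of two copies of Y as a near A-set.) -/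
open Set

/-- `X` is balanceably near isomorphic to two copies of `Y`: there is a commensurated
subset `U` with `X = U ⊔ τ(U)`, and `f` restricts to a bijection of `U` onto `Y`. -/
theorem balanced_splitting_along_involution
    {A X Y : Type*} [CommGroup A] [Group.FG A]
    (α : A →* Equiv.Perm X)
    (horb : ∃ T : Finset X, ∀ x : X, ∃ t ∈ T, ∃ g : A, α g t = x)
    (τ : X → X) (hτ2 : ∀ x : X, τ (τ x) = x) (hτfix : ∀ x : X, τ x ≠ x)
    (hnear : ∀ g : A, {x : X | τ (α g x) ≠ α g (τ x)}.Finite)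
    (hstar : ∀ g : A, {x : X | α g x = τ x}.Finite)
    (f : X → Y) (hsurj : Function.Surjective f)
    (hfib : ∀ x : X, f ⁻¹' {f x} = {x, τ x}) :
    ∃ U : Set X, U ∩ (τ '' U) = ∅ ∧ U ∪ (τ '' U) = Set.univ ∧
      CommensuratedAct α U ∧ Set.BijOn f U Set.univ := by
  classical
  obtain ⟨T, hT⟩ := horb
  obtain ⟨S, hS⟩ := (Group.FG.out : (⊤ : Subgroup A).FG)
  -- good edges of the Schreier graph
  let r : X → X → Prop := fun x y => ∃ s ∈ S, y = α s x ∧ τ y = α s (τ x)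
  let q : X → Quot r := Quot.mk r
  have hcomm : ∀ (g h : A) (x : X), α g (α h x) = α h (α g x) := by
    intro g h x
    rw [← Equiv.Perm.mul_apply, ← Equiv.Perm.mul_apply, ← map_mul, ← map_mul, mul_comm]
  have hinv1 : ∀ (g : A) (x : X), α g⁻¹ (α g x) = x := by
    intro g x
    rw [← Equiv.Perm.mul_apply, ← map_mul, inv_mul_cancel, map_one, Equiv.Perm.one_apply]
  have hinv2 : ∀ (g : A) (x : X), α g (α g⁻¹ x) = x := by
    intro g x
    rw [← Equiv.Perm.mul_apply, ← map_mul, mul_inv_cancel, map_one, Equiv.Perm.one_apply]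
  have hqτ : ∀ x y, q x = q y → q (τ x) = q (τ y) := by
    intro x y h
    let F : Quot r → Quot r := Quot.lift (fun x => q (τ x)) (by
      rintro a b ⟨s, hs, h1, h2⟩
      refine Quot.sound ⟨s, hs, h2, ?_⟩
      rw [hτ2, hτ2, h1])
    exact congrArg F h
  have hqorb : ∀ x y, q x = q y → ∃ g : A, α g x = y := by
    intro x y h
    let F : Quot r → Prop := Quot.lift (fun y => ∃ g : A, α g x = y) (by
      rintro a b ⟨s, hs, h1, h2⟩
      refine propext ⟨?_, ?_⟩
      · rintro ⟨g, rfl⟩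
        exact ⟨s * g, by rw [h1, map_mul, Equiv.Perm.mul_apply]⟩
      · rintro ⟨g, hg⟩
        refine ⟨s⁻¹ * g, ?_⟩
        rw [map_mul, Equiv.Perm.mul_apply, hg, h1, hinv1])
    have heq : F (q x) = F (q y) := congrArg F h
    have h0 : F (q x) := ⟨1, by simp⟩
    rw [heq] at h0
    exact h0
  have hqg : ∀ (g : A) x y, q x = q y → α g x = τ x → α g y = τ y := by
    intro g x y h h0
    let F : Quot r → Prop := Quot.lift (fun y => α g y = τ y) (by
      rintro a b ⟨s, hs, h1, h2⟩
      refine propext ?_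
      rw [h2, h1, hcomm g s, (α s).injective.eq_iff])
    have heq : F (q x) = F (q y) := congrArg F h
    have hbase : F (q x) := h0
    rw [heq] at hbase
    exact hbase
  -- components stable under the involution are finite
  have hfinC : ∀ c, q c = q (τ c) → {x | q x = q c}.Finite := by
    intro c hc
    obtain ⟨g, hg⟩ := hqorb _ _ hc
    exact (hstar g).subset fun x hx => hqg g c x (Eq.symm hx) hg
  -- finitely many components
  let B0 : Set X := ⋃ s ∈ S, {x | τ (α s x) ≠ α s (τ x)}
  have hB0 : B0.Finite := S.finite_toSet.biUnion fun s _ => hnear s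
  let B1 : Set X := ⋃ s ∈ S, α s '' B0
  have hB1 : B1.Finite := S.finite_toSet.biUnion fun s _ => hB0.image _
  let R : Set X := B0 ∪ B1 ∪ T
  have hR : R.Finite := (hB0.union hB1).union T.finite_toSet
  have hedge : ∀ s ∈ S, ∀ x, x ∉ B0 → q x = q (α s x) := by
    intro s hs x hx
    refine Quot.sound ⟨s, hs, rfl, ?_⟩
    by_contra h
    exact hx (mem_iUnion₂.2 ⟨s, hs, h⟩)
  have hrep : ∀ x, ∃ c ∈ R, q x = q c := by
    intro x
    obtain ⟨t, ht, g, rfl⟩ := hT x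
    have hg : g ∈ Subgroup.closure (S : Set A) := by rw [hS]; trivial
    induction hg using Subgroup.closure_induction_left with
    | one => exact ⟨t, Or.inr ht, by simp⟩
    | mul_left s hs g _ ih =>
      obtain ⟨c, hc, h⟩ := ih
      rw [map_mul, Equiv.Perm.mul_apply]
      by_cases hb : α g t ∈ B0
      · exact ⟨_, Or.inl (Or.inr (mem_iUnion₂.2 ⟨s, hs, mem_image_of_mem _ hb⟩)), rfl⟩
      · exact ⟨c, hc, (hedge s hs _ hb).symm.trans h⟩
    | inv_mul_cancel s hs g _ ih =>
      obtain ⟨c, hc, h⟩ := ih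
      rw [map_mul, Equiv.Perm.mul_apply]
      by_cases hb : α s⁻¹ (α g t) ∈ B0
      · exact ⟨_, Or.inl (Or.inl hb), rfl⟩
      · refine ⟨c, hc, (hedge s hs _ hb).trans ?_⟩
        rw [hinv2]
        exact h
  let K : Set X := {x | q x = q (τ x)}
  have hK : K.Finite := by
    have : (⋃ c ∈ R ∩ K, {x | q x = q c}).Finite :=
      (hR.subset inter_subset_left).biUnion fun c hc => hfinC c hc.2
    refine this.subset fun x hx => ?_
    obtain ⟨c, hc, h⟩ := hrep x
    refine mem_iUnion₂.2 ⟨c, ⟨hc, ?_⟩, h⟩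
    exact h.symm.trans (Eq.trans hx (hqτ _ _ h))
  -- the transversal
  let _ : LinearOrder X := linearOrderOfSTO WellOrderingRel
  let _ : LinearOrder (Quot r) := linearOrderOfSTO WellOrderingRel
  let U : Set X := {x | q x < q (τ x) ∨ (q x = q (τ x) ∧ x < τ x)}
  have hU : ∀ x, τ x ∈ U ↔ x ∉ U := by
    intro x
    have h1 := hτfix x
    simp only [U, mem_ofPred_eq, hτ2]
    rcases lt_trichotomy (q x) (q (τ x)) with h | h | h
    · simp [h, h.not_gt, h.ne']
    · rcases lt_or_gt_of_ne h1 with h2 | h2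
      · simp [h, h2, h2.not_gt]
      · simp [h, h2, h2.not_gt]
    · simp [h, h.not_gt, h.ne']
  have hmemτ : ∀ x, x ∈ τ '' U ↔ x ∉ U := by
    intro x
    rw [← hU]
    constructor
    · rintro ⟨y, hy, rfl⟩
      rwa [hτ2]
    · intro h
      exact ⟨_, h, hτ2 x⟩
  have hD : ∀ g : A, {x | ¬ (x ∈ U ↔ α g x ∈ U)}.Finite := by
    intro g
    have hg : g ∈ Subgroup.closure (S : Set A) := by rw [hS]; trivial
    induction hg using Subgroup.closure_induction with
    | mem s hs =>
      refine (hB0.union hK).subset fun x hx => ?_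
      by_contra hn
      simp only [mem_union, not_or] at hn
      obtain ⟨hn1, hn2⟩ := hn
      have e1 := hedge s hs x hn1
      have e2 := hqτ _ _ e1
      apply hx
      have hne : ¬ q x = q (τ x) := hn2
      simp only [U, mem_ofPred_eq, ← e1, ← e2, hne, false_and, or_false]
    | one => simp
    | mul g h _ _ ihg ihh =>
      refine (ihh.union (ihg.preimage (f := α h) (α h).injective.injOn)).subset fun x hx => ?_
      simp only [map_mul, Equiv.Perm.mul_apply, mem_ofPred_eq, mem_union, mem_preimage] at hx ⊢
      tauto
    | inv g _ ih =>
      refine (ih.preimage (f := α g⁻¹) (α g⁻¹).injective.injOn).subset fun x hx => ?_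
      simp only [mem_ofPred_eq, mem_preimage, hinv2] at hx ⊢
      tauto
  refine ⟨U, ?_, ?_, ?_, ?_, ?_, ?_⟩
  · ext x
    simp [-mem_image, hmemτ]
  · ext x
    simp only [mem_union, hmemτ, mem_univ, iff_true]
    exact em _
  · intro g
    refine ((hD g).image (α g)).subset ?_
    rintro y (⟨⟨x, hx, rfl⟩, hy⟩ | ⟨hy, hn⟩)
    · exact ⟨x, fun h => hy (h.1 hx), rfl⟩
    · refine ⟨(α g).symm y, fun h => hn ⟨(α g).symm y, h.2 ?_, ?_⟩, ?_⟩ <;> simp [hy]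
  · exact fun _ _ => mem_univ _
  · intro x hx y hy h
    have : y ∈ f ⁻¹' {f x} := h.symm
    rw [hfib] at this
    rcases this with h | h
    · exact h.symm
    · rw [mem_singleton_iff] at h
      rw [h] at hy
      exact absurd hx ((hU x).1 hy)
  · intro y _
    obtain ⟨x, rfl⟩ := hsurj y
    by_cases hx : x ∈ U
    · exact ⟨x, hx, rfl⟩
    · refine ⟨τ x, (hU x).2 hx, ?_⟩
      have : τ x ∈ f ⁻¹' {f x} := by rw [hfib]; simp
      exact this
end
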